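/- For every x > 0, every real τ, and every γ ∈ (0, 1/4), one has (1/x) ∫_0^x Φ_τ(y) dy = (1/(2πi)) ∫_{γ−i∞}^{γ+i∞} [Γ(s+iτ)Γ(s−iτ)Γ(1/2−s) / (Γ(s)Γ(1−s)Γ(2−s))] x^{−s} ds. -/

import Mathlib

open Complex MeasureTheory Real Set

/-- Bessel function of the first kind, defined by its power series. -/
noncomputable def besselJ (ν z : ℂ) : ℂ :=
  ∑' k : ℕ, ((-1 : ℂ) ^ k * (z / 2) ^ (2 * (k : ℂ) + ν)) /
    ((k.factorial : ℂ) * Complex.Gamma ((k : ℂ) + ν + 1))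

/-- The kernel `Φ_τ(x) = (√π / cosh(πτ)) · Re[J_{iτ}(√x)²]`. -/
noncomputable def Phi (τ x : ℝ) : ℝ :=
  (Real.sqrt π / Real.cosh (π * τ)) * ((besselJ (Complex.I * τ) (Real.sqrt x : ℂ)) ^ 2).re

/-- The integrand of the Mellin–Barnes representation (1.12) on the line `Re s = γ`,
with denominator `Γ(s)Γ(1−s)Γ(2−s)`. -/
noncomputable def mellinBarnesRatio' (γ τ : ℝ) (t : ℝ) : ℂ :=
  Complex.Gamma ((γ : ℂ) + t * Complex.I + Complex.I * τ) *
      Complex.Gamma ((γ : ℂ) + t * Complex.I - Complex.I * τ) *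
      Complex.Gamma (1 / 2 - ((γ : ℂ) + t * Complex.I)) /
    (Complex.Gamma ((γ : ℂ) + t * Complex.I) *
      Complex.Gamma (1 - ((γ : ℂ) + t * Complex.I)) *
      Complex.Gamma (2 - ((γ : ℂ) + t * Complex.I)))

theorem Complex.norm_Gamma_mul_Gamma_le_of_le {a b u : ℝ} (ha : 0 < a) (hab : a ≤ b) :
    ‖Complex.Gamma (a + u * I)‖ * Real.Gamma b ≤ Real.Gamma a * ‖Complex.Gamma (b + u * I)‖ := by
  have h1 := ((Complex.GammaSeq_tendsto_Gamma (a + u * I)).norm).mul (Real.GammaSeq_tendsto_Gamma b)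
  have h2 := (Real.GammaSeq_tendsto_Gamma a).mul (Complex.GammaSeq_tendsto_Gamma (b + u * I)).norm
  refine le_of_tendsto_of_tendsto h1 h2 ?_
  filter_upwards [Filter.eventually_gt_atTop 0] with n hn
  have hb := ha.trans_le hab
  have hn' : (0 : ℝ) < n := by exact_mod_cast hn
  simp only [Complex.GammaSeq, Real.GammaSeq, norm_div, norm_mul, norm_prod]
  rw [Complex.norm_natCast_cpow_of_pos hn, Complex.norm_natCast_cpow_of_pos hn]
  have key : ∀ c : ℝ, 0 < c → ∀ j : ℕ, 0 < ‖(c : ℂ) + u * I + j‖ := by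
    intro c hc j
    rw [norm_pos_iff]
    intro h
    have := congrArg Complex.re h
    simp at this
    have hj : (0:ℝ) ≤ j := by positivity
    linarith
  have e : (∏ j ∈ Finset.range (n + 1), (a + (j:ℝ))) * (∏ j ∈ Finset.range (n + 1), ‖(b : ℂ) + u * I + j‖)
      ≤ (∏ j ∈ Finset.range (n + 1), ‖(a : ℂ) + u * I + j‖) * (∏ j ∈ Finset.range (n + 1), (b + (j:ℝ))) := by
    rw [← Finset.prod_mul_distrib, ← Finset.prod_mul_distrib]
    refine Finset.prod_le_prod (fun j _ => by positivity) fun j _ => ?_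
    have hj : (0:ℝ) ≤ j := by positivity
    refine abs_le_of_sq_le_sq' ?_ (by positivity) |>.2
    rw [mul_pow, mul_pow, ← Complex.normSq_eq_norm_sq, ← Complex.normSq_eq_norm_sq]
    simp [Complex.normSq_apply]
    have : (a + j)^2 * (u*u) ≤ (b+j)^2*(u*u) := by
      have := mul_self_nonneg u
      gcongr
    nlinarith
  simp only [add_re, ofReal_re, mul_re, I_re, mul_zero, ofReal_im, I_im, mul_one, sub_self, add_zero,
    Complex.norm_natCast]
  have p1 : 0 < ∏ j ∈ Finset.range (n + 1), (a + (j:ℝ)) := Finset.prod_pos fun j _ => by positivity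
  have p2 : 0 < ∏ j ∈ Finset.range (n + 1), (b + (j:ℝ)) := Finset.prod_pos fun j _ => by positivity
  have p3 := Finset.prod_pos (s := Finset.range (n + 1)) fun j _ => key a ha j
  have p4 := Finset.prod_pos (s := Finset.range (n + 1)) fun j _ => key b hb j
  rw [div_mul_div_comm, div_mul_div_comm, div_le_div_iff₀ (by positivity) (by positivity)]
  have hc : 0 ≤ (n:ℝ)^a * n.factorial * ((n:ℝ)^b * n.factorial) := by positivity
  nlinarith [mul_le_mul_of_nonneg_left e hc]

theorem Complex.norm_Gamma_mul_norm_Gamma_add_one_le {σ u : ℝ} (hσ : 0 < σ) :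
    ‖Complex.Gamma (σ + u * I)‖ * ‖Complex.Gamma (σ + u * I + 1)‖ * Real.Gamma (σ + 1 / 2) ^ 2 ≤
      Real.Gamma σ * Real.Gamma (σ + 1) * ‖Complex.Gamma (σ + u * I + 1 / 2)‖ ^ 2 := by
  have h1 := (((Complex.GammaSeq_tendsto_Gamma (σ + u * I)).norm).mul
    (Complex.GammaSeq_tendsto_Gamma (σ + u * I + 1)).norm).mul
    ((Real.GammaSeq_tendsto_Gamma (σ + 1 / 2)).pow 2)
  have h2 := ((Real.GammaSeq_tendsto_Gamma σ).mul (Real.GammaSeq_tendsto_Gamma (σ + 1))).mul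
    ((Complex.GammaSeq_tendsto_Gamma (σ + u * I + 1 / 2)).norm.pow 2)
  refine le_of_tendsto_of_tendsto h1 h2 ?_
  filter_upwards [Filter.eventually_gt_atTop 0] with n hn
  have hn' : (0 : ℝ) < n := by exact_mod_cast hn
  simp only [Complex.GammaSeq, Real.GammaSeq, norm_div, norm_mul, norm_prod]
  rw [Complex.norm_natCast_cpow_of_pos hn, Complex.norm_natCast_cpow_of_pos hn,
    Complex.norm_natCast_cpow_of_pos hn]
  have key : ∀ (c : ℝ) (j : ℕ), 0 ≤ c → 0 < ‖(σ : ℂ) + u * I + c + j‖ := by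
    intro c j hc
    rw [norm_pos_iff]
    intro h
    have := congrArg Complex.re h
    simp at this
    have hj : (0:ℝ) ≤ j := by positivity
    linarith
  have k0 : ∀ j : ℕ, 0 < ‖(σ : ℂ) + u * I + j‖ := by simpa using fun j => key 0 j le_rfl
  have k1 : ∀ j : ℕ, 0 < ‖(σ : ℂ) + u * I + 1 + j‖ := by simpa using fun j => key 1 j zero_le_one
  have k2 : ∀ j : ℕ, 0 < ‖(σ : ℂ) + u * I + 1 / 2 + j‖ := by
    simpa using fun j => key (1/2) j (by norm_num)
  have e : (∏ j ∈ Finset.range (n + 1), (σ + (j:ℝ))) * (∏ j ∈ Finset.range (n + 1), (σ + 1 + (j:ℝ))) *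
      (∏ j ∈ Finset.range (n + 1), ‖(σ : ℂ) + u * I + 1 / 2 + j‖) ^ 2
      ≤ (∏ j ∈ Finset.range (n + 1), ‖(σ : ℂ) + u * I + j‖) *
        (∏ j ∈ Finset.range (n + 1), ‖(σ : ℂ) + u * I + 1 + j‖) *
        (∏ j ∈ Finset.range (n + 1), (σ + 1 / 2 + (j:ℝ))) ^ 2 := by
    simp only [← Finset.prod_mul_distrib, ← Finset.prod_pow]
    refine Finset.prod_le_prod (fun j _ => by positivity) fun j _ => ?_
    have hj : (0:ℝ) ≤ j := by positivity
    set w : ℂ := ((σ : ℂ) + u * I + j) * ((σ : ℂ) + u * I + 1 + j) with hw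
    have hw1 : ((σ : ℂ) + u * I + 1 / 2 + j) ^ 2 = w + ((1 / 4 : ℝ) : ℂ) := by
      rw [hw]; push_cast; ring
    have hw2 : (σ + j) * (σ + 1 + j) ≤ ‖w‖ := by
      rw [hw, norm_mul]
      have a1 := Complex.re_le_norm ((σ : ℂ) + u * I + j)
      have a2 := Complex.re_le_norm ((σ : ℂ) + u * I + 1 + j)
      simp at a1 a2
      gcongr
    rw [← norm_pow, hw1, ← norm_mul, ← hw]
    have := norm_add_le w ((1 / 4 : ℝ) : ℂ)
    rw [Complex.norm_real, Real.norm_of_nonneg (by norm_num : (0:ℝ) ≤ 1/4)] at this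
    have h0 : 0 ≤ (σ + j) * (σ + 1 + j) := by positivity
    nlinarith [mul_le_mul_of_nonneg_left this h0]
  simp only [add_re, ofReal_re, mul_re, I_re, mul_zero, ofReal_im, I_im, mul_one, sub_self, add_zero,
    Complex.norm_natCast]
  have hre : ((1:ℂ)/2).re = 1/2 := by norm_num
  rw [hre, one_re]
  have p1 : 0 < ∏ j ∈ Finset.range (n + 1), (σ + (j:ℝ)) := Finset.prod_pos fun j _ => by positivity
  have p2 : 0 < ∏ j ∈ Finset.range (n + 1), (σ + 1 + (j:ℝ)) := Finset.prod_pos fun j _ => by positivity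
  have p2' : 0 < ∏ j ∈ Finset.range (n + 1), (σ + 1 / 2 + (j:ℝ)) := Finset.prod_pos fun j _ => by positivity
  have p3 := Finset.prod_pos (s := Finset.range (n + 1)) fun j _ => k0 j
  have p4 := Finset.prod_pos (s := Finset.range (n + 1)) fun j _ => k1 j
  have p5 := Finset.prod_pos (s := Finset.range (n + 1)) fun j _ => k2 j
  rw [div_pow, div_pow, div_mul_div_comm, div_mul_div_comm, div_mul_div_comm, div_mul_div_comm,
    div_le_div_iff₀ (by positivity) (by positivity)]
  have hc : 0 ≤ (n:ℝ)^σ * n.factorial * ((n:ℝ)^(σ+1) * n.factorial) * ((n:ℝ)^(σ + 1/2) * n.factorial)^2 := by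
    positivity
  nlinarith [mul_le_mul_of_nonneg_left e hc]

/-- The Mellin transform of `x ↦ √π x⁻¹ ∫₀ˣ J_ν(√y)² dy`. -/
noncomputable def barnesKernel (ν s : ℂ) : ℂ :=
  Complex.Gamma (s + ν) * Complex.Gamma (1 / 2 - s) /
    (Complex.Gamma (2 - s) * Complex.Gamma (1 + ν - s))

theorem Complex.norm_sin_le_exp (z : ℂ) : ‖Complex.sin z‖ ≤ Real.exp |z.im| := by
  rw [Complex.sin, norm_div, norm_mul, norm_I, mul_one, Complex.norm_ofNat, div_le_iff₀ two_pos]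
  refine (norm_sub_le _ _).trans ?_
  rw [Complex.norm_exp, Complex.norm_exp]
  simp only [neg_mul, neg_re, mul_re, I_re, mul_zero, I_im, mul_one, zero_sub, neg_neg]
  have h1 := Real.exp_le_exp.2 (le_abs_self z.im)
  have h2 := Real.exp_le_exp.2 (neg_le_abs z.im)
  linarith

theorem Complex.exp_le_four_mul_norm_sin {z : ℂ} (hz : 1 ≤ |z.im|) :
    Real.exp |z.im| ≤ 4 * ‖Complex.sin z‖ := by
  rw [Complex.sin, norm_div, norm_mul, norm_I, mul_one, Complex.norm_ofNat]
  have h := abs_norm_sub_norm_le (Complex.exp (-z * I)) (Complex.exp (z * I))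
  rw [Complex.norm_exp, Complex.norm_exp] at h
  simp only [neg_mul, neg_re, mul_re, I_re, mul_zero, I_im, mul_one, zero_sub, neg_neg] at h
  have e1 : 2 * Real.exp (-|z.im|) ≤ Real.exp |z.im| := by
    have a1 : Real.exp (-|z.im|) ≤ 1 := Real.exp_le_one_iff.2 (by linarith)
    have a2 := Real.add_one_le_exp |z.im|
    linarith
  have e2 : Real.exp |z.im| - Real.exp (-|z.im|) ≤ |Real.exp z.im - Real.exp (-z.im)| := by
    rcases abs_cases z.im with ⟨h1, _⟩ | ⟨h1, _⟩ <;> rw [h1]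
    · exact le_abs_self _
    · rw [neg_neg]
      exact (neg_sub (Real.exp z.im) _) ▸ neg_le_abs _
  rw [neg_mul]
  linarith

theorem Complex.norm_Gamma_le_norm_Gamma_one_sub {z : ℂ} (h1 : -1 < z.re) (h2 : z.re ≤ 1 / 2)
    (h : 1 ≤ |z.im|) :
    ‖Complex.Gamma z‖ ≤
      2 * Real.Gamma (z.re + 1) / Real.Gamma (2 - z.re) * ‖Complex.Gamma (1 - z)‖ := by
  have k := Complex.norm_Gamma_mul_Gamma_le_of_le (a := z.re + 1) (b := 2 - z.re) (u := z.im)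
    (by linarith) (by linarith)
  have g : 0 < Real.Gamma (2 - z.re) := Real.Gamma_pos_of_pos (by linarith)
  have z0 : z ≠ 0 := by rintro rfl; norm_num at h
  have z1 : (1 - z) ≠ 0 := by
    intro h'
    rw [← sub_eq_zero.1 h'] at h
    norm_num at h
  have e1 : (((z.re + 1 : ℝ) : ℂ) + z.im * I) = z + 1 := by
    apply Complex.ext <;> simp
  have e2 : (((2 - z.re : ℝ) : ℂ) + z.im * I) = (starRingEnd ℂ) ((1 - z) + 1) := by
    apply Complex.ext <;> simp
    ring
  rw [e1, e2, Complex.Gamma_conj, Complex.norm_conj, Complex.Gamma_add_one _ z0,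
    Complex.Gamma_add_one _ z1, norm_mul, norm_mul] at k
  have hz : 1 ≤ ‖z‖ := h.trans (Complex.abs_im_le_norm z)
  have h1z : ‖1 - z‖ ≤ 2 * ‖z‖ := by
    refine (norm_sub_le _ _).trans ?_
    rw [norm_one]; linarith
  have g' : 0 < Real.Gamma (z.re + 1) := Real.Gamma_pos_of_pos (by linarith)
  rw [div_mul_eq_mul_div, le_div_iff₀ g]
  refine le_of_mul_le_mul_left (a := ‖z‖) ?_ (by linarith)
  have := mul_le_mul_of_nonneg_left h1z (mul_nonneg g'.le (norm_nonneg (Complex.Gamma (1 - z))))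
  linarith

theorem Complex.norm_Gamma_add_le_norm_Gamma_sub {σ t τ : ℝ} (h1 : -1 < σ) (h2 : σ ≤ 1 / 2)
    (h : 1 + |τ| ≤ |t|) :
    ‖Complex.Gamma (σ + t * I + I * τ)‖ ≤
      4 * Real.Gamma (σ + 1) / Real.Gamma (2 - σ) * Real.exp (π * |τ|) *
        ‖Complex.Gamma (1 + I * τ - (σ + t * I))‖ := by
  set D := 2 * Real.Gamma (σ + 1) / Real.Gamma (2 - σ) with hD
  have hD0 : 0 < D := by
    have := Real.Gamma_pos_of_pos (s := σ + 1) (by linarith)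
    have := Real.Gamma_pos_of_pos (s := 2 - σ) (by linarith)
    positivity
  have key : ∀ u : ℝ, 1 ≤ |u| → ‖Complex.Gamma (σ + u * I)‖ ≤ D * ‖Complex.Gamma (1 - (σ + u * I))‖ ∧
      ‖Complex.Gamma (σ + u * I)‖ * ‖Complex.Gamma (1 - (σ + u * I))‖ ≤ 4 * π * Real.exp (-(π * |u|)) ∧
      π * Real.exp (-(π * |u|)) ≤ ‖Complex.Gamma (σ + u * I)‖ * ‖Complex.Gamma (1 - (σ + u * I))‖ := by
    intro u hu
    have hr := Complex.norm_Gamma_le_norm_Gamma_one_sub (z := σ + u * I) (by simpa)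
      (by simpa using h2.trans_eq (by norm_num)) (by simpa)
    refine ⟨by simpa [hD] using hr, ?_⟩
    have him : (π * ((σ : ℂ) + u * I)).im = π * u := by simp
    have habs : |(π * ((σ : ℂ) + u * I)).im| = π * |u| := by
      rw [him, abs_mul, abs_of_pos Real.pi_pos]
    have hpu : 1 ≤ π * |u| := by nlinarith [Real.pi_gt_three]
    have s1 := Complex.norm_sin_le_exp (π * ((σ : ℂ) + u * I))
    have s2 := Complex.exp_le_four_mul_norm_sin (z := π * ((σ : ℂ) + u * I)) (by rw [habs]; exact hpu)
    rw [habs] at s1 s2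
    have hE := Real.exp_pos (π * |u|)
    have hs : 0 < ‖Complex.sin (π * ((σ : ℂ) + u * I))‖ := by linarith
    have hpi := Real.pi_pos
    rw [← norm_mul, Complex.Gamma_mul_Gamma_one_sub, norm_div, Complex.norm_real,
      Real.norm_of_nonneg Real.pi_pos.le, Real.exp_neg]
    constructor
    · rw [div_le_iff₀ hs, ← div_eq_mul_inv, div_mul_eq_mul_div, le_div_iff₀ hE]
      nlinarith
    · rw [le_div_iff₀ hs, ← div_eq_mul_inv, div_mul_eq_mul_div, div_le_iff₀ hE]
      nlinarith
  have hp : 1 ≤ |t + τ| := by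
    have := abs_sub_abs_le_abs_add t τ
    linarith
  have hm : 1 ≤ |t - τ| := by
    have := abs_sub_abs_le_abs_sub t τ
    linarith
  obtain ⟨a1, a2, -⟩ := key _ hp
  obtain ⟨b1, -, b3⟩ := key _ hm
  have e1 : (σ : ℂ) + t * I + I * τ = σ + (t + τ : ℝ) * I := by push_cast; ring
  have e2 : 1 + I * τ - ((σ : ℂ) + t * I) = 1 - (σ + (t - τ : ℝ) * I) := by push_cast; ring
  rw [e1, e2]
  set A := ‖Complex.Gamma (σ + (t + τ : ℝ) * I)‖
  set A' := ‖Complex.Gamma (1 - (σ + (t + τ : ℝ) * I))‖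
  set B := ‖Complex.Gamma (σ + (t - τ : ℝ) * I)‖
  set B' := ‖Complex.Gamma (1 - (σ + (t - τ : ℝ) * I))‖
  have hA : 0 ≤ A := norm_nonneg _
  have hB' : 0 ≤ B' := norm_nonneg _
  have q1 : A ^ 2 ≤ D * (4 * π * Real.exp (-(π * |t + τ|))) := by
    nlinarith [mul_le_mul_of_nonneg_left a1 hA, mul_le_mul_of_nonneg_left a2 hD0.le]
  have q2 : π * Real.exp (-(π * |t - τ|)) ≤ D * B' ^ 2 := by
    nlinarith [mul_le_mul_of_nonneg_right b1 hB']
  have q3 : Real.exp (-(π * |t + τ|)) ≤ Real.exp (π * |τ|) ^ 2 * Real.exp (-(π * |t - τ|)) := by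
    rw [← Real.exp_nat_mul, ← Real.exp_add, Real.exp_le_exp]
    have : |t - τ| ≤ |t + τ| + 2 * |τ| := by
      have := norm_sub_le (t + τ) (2 * τ)
      rw [norm_mul, Real.norm_eq_abs, Real.norm_eq_abs, Real.norm_eq_abs, Real.norm_eq_abs, abs_two] at this
      rwa [(by ring : t + τ - 2 * τ = t - τ)] at this
    push_cast
    nlinarith [Real.pi_pos]
  have e3 : 4 * Real.Gamma (σ + 1) / Real.Gamma (2 - σ) = 2 * D := by rw [hD]; ring
  rw [e3]
  refine abs_le_of_sq_le_sq' ?_ (by positivity) |>.2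
  have q4 := mul_le_mul_of_nonneg_left q3 (by positivity : 0 ≤ D * (4 * π))
  have q5 := mul_le_mul_of_nonneg_left q2 (by positivity : 0 ≤ 4 * D * Real.exp (π * |τ|) ^ 2)
  nlinarith

theorem Complex.norm_Gamma_half_sub_le {σ t : ℝ} (h : σ < 1 / 2) (ht : t ≠ 0) :
    ‖Complex.Gamma (1 / 2 - (σ + t * I))‖ ≤
      √(Real.Gamma (1 / 2 - σ) * Real.Gamma (3 / 2 - σ)) / Real.Gamma (1 - σ) *
        |t| ^ (-(3 / 2) : ℝ) * ‖Complex.Gamma (2 - (σ + t * I))‖ := by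
  have k := Complex.norm_Gamma_mul_norm_Gamma_add_one_le (σ := 1 / 2 - σ) (u := -t) (by linarith)
  set s : ℂ := σ + t * I with hs
  have him : s.im = t := by simp [hs]
  have e1 : (((1 / 2 - σ : ℝ) : ℂ) + (-t : ℝ) * I) = 1 / 2 - s := by
    rw [hs]; push_cast; ring
  have z0 : (1 / 2 - s) ≠ 0 := by
    intro h'
    apply ht
    have := congrArg Complex.im h'
    simpa [him] using this
  have z1 : (1 - s) ≠ 0 := by
    intro h'
    apply ht
    have := congrArg Complex.im h'
    simpa [him] using this
  have n0 : |t| ≤ ‖1 / 2 - s‖ := by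
    have := Complex.abs_im_le_norm (1 / 2 - s)
    simpa [him] using this
  have n1 : |t| ≤ ‖1 - s‖ := by
    have := Complex.abs_im_le_norm (1 - s)
    simpa [him] using this
  rw [e1, Complex.Gamma_add_one _ z0, norm_mul, (by ring : 1 / 2 - s + 1 / 2 = 1 - s),
    (by ring : 1 / 2 - σ + 1 / 2 = 1 - σ), (by ring : 1 / 2 - σ + 1 = 3 / 2 - σ)] at k
  have e2 : 2 - s = (1 - s) + 1 := by ring
  rw [e2, Complex.Gamma_add_one _ z1, norm_mul]
  have g1 := Real.Gamma_pos_of_pos (s := 1 / 2 - σ) (by linarith)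
  have g2 := Real.Gamma_pos_of_pos (s := 3 / 2 - σ) (by linarith)
  have g3 := Real.Gamma_pos_of_pos (s := 1 - σ) (by linarith)
  have ht' : 0 < |t| := abs_pos.2 ht
  refine abs_le_of_sq_le_sq' ?_ (by positivity) |>.2
  have e3 : (|t| ^ (-(3 / 2) : ℝ)) ^ 2 = (|t| ^ 3)⁻¹ := by
    rw [← Real.rpow_natCast, ← Real.rpow_mul ht'.le, ← Real.rpow_natCast, ← Real.rpow_neg ht'.le]
    norm_num
  rw [mul_pow, mul_pow, mul_pow, div_pow, Real.sq_sqrt (by positivity), e3, ← div_eq_mul_inv, div_div,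
    div_mul_eq_mul_div, le_div_iff₀ (by positivity)]
  calc ‖Complex.Gamma (1 / 2 - s)‖ ^ 2 * (Real.Gamma (1 - σ) ^ 2 * |t| ^ 3)
      = (‖Complex.Gamma (1 / 2 - s)‖ * (|t| * ‖Complex.Gamma (1 / 2 - s)‖) * Real.Gamma (1 - σ) ^ 2)
        * |t| ^ 2 := by ring
    _ ≤ (‖Complex.Gamma (1 / 2 - s)‖ * (‖1 / 2 - s‖ * ‖Complex.Gamma (1 / 2 - s)‖) * Real.Gamma (1 - σ) ^ 2)
        * ‖1 - s‖ ^ 2 := by gcongr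
    _ ≤ _ := by
      have := mul_le_mul_of_nonneg_right k (sq_nonneg ‖1 - s‖)
      linarith

theorem exists_norm_barnesKernel_le (τ : ℝ) {a b : ℝ} (ha : -1 < a) (hb : b < 1 / 2) :
    ∃ C, ∀ σ ∈ Icc a b, ∀ t : ℝ, 1 + |τ| ≤ |t| →
      ‖barnesKernel (I * τ) (σ + t * I)‖ ≤ C * |t| ^ (-(3 / 2) : ℝ) := by
  let c : ℝ → ℝ := fun σ => 4 * Real.Gamma (σ + 1) / Real.Gamma (2 - σ) * Real.exp (π * |τ|) *
    (√(Real.Gamma (1 / 2 - σ) * Real.Gamma (3 / 2 - σ)) / Real.Gamma (1 - σ))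
  have hΓ : ∀ x : ℝ, 0 < x → ContinuousAt Real.Gamma x := fun x hx =>
    (Real.differentiableAt_Gamma fun m => by
      have : (0:ℝ) ≤ m := by positivity
      linarith).continuousAt
  have hc : ContinuousOn c (Icc a b) := by
    intro σ hσ
    refine ContinuousAt.continuousWithinAt ?_
    obtain ⟨h1, h2⟩ := hσ
    have c1 : ContinuousAt (fun σ => Real.Gamma (σ + 1)) σ :=
      ContinuousAt.comp (g := Real.Gamma) (hΓ _ (by linarith)) (by fun_prop)
    have c2 : ∀ r : ℝ, σ < r → ContinuousAt (fun σ => Real.Gamma (r - σ)) σ := fun r hr =>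
      ContinuousAt.comp (g := Real.Gamma) (hΓ _ (by linarith)) (by fun_prop)
    have n2 : ∀ r : ℝ, σ < r → Real.Gamma (r - σ) ≠ 0 := fun r hr =>
      (Real.Gamma_pos_of_pos (by linarith)).ne'
    have := c2 2 (by linarith)
    have := n2 2 (by linarith)
    have := c2 1 (by linarith)
    have := n2 1 (by linarith)
    have := c2 (1 / 2) (by linarith)
    have := c2 (3 / 2) (by linarith)
    fun_prop (disch := assumption)
  obtain ⟨C, hC⟩ := isCompact_Icc.exists_bound_of_continuousOn hc
  refine ⟨C, fun σ hσ t ht => ?_⟩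
  have ht0 : t ≠ 0 := by
    rintro rfl
    rw [abs_zero] at ht
    linarith [abs_nonneg τ]
  have k1 := Complex.norm_Gamma_add_le_norm_Gamma_sub (σ := σ) (t := t) (τ := τ) (by linarith [hσ.1])
    (by linarith [hσ.2]) ht
  have k2 := Complex.norm_Gamma_half_sub_le (σ := σ) (by linarith [hσ.2]) ht0
  have hcσ := (le_abs_self _).trans (hC σ hσ)
  rw [barnesKernel, norm_div, norm_mul, norm_mul]
  have d1 : 0 < ‖Complex.Gamma (2 - (σ + t * I))‖ := norm_pos_iff.2
    (Complex.Gamma_ne_zero_of_re_pos (by simp; linarith [hσ.2]))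
  have d2 : 0 < ‖Complex.Gamma (1 + I * τ - (σ + t * I))‖ := norm_pos_iff.2
    (Complex.Gamma_ne_zero_of_re_pos (by simp; linarith [hσ.2]))
  rw [div_le_iff₀ (by positivity)]
  calc _ ≤ _ := mul_le_mul k1 k2 (norm_nonneg _) ((norm_nonneg _).trans k1)
    _ = c σ * |t| ^ (-(3 / 2) : ℝ) * (‖Complex.Gamma (2 - (σ + t * I))‖ *
        ‖Complex.Gamma (1 + I * τ - (σ + t * I))‖) := by
      simp only [c]; ring
    _ ≤ _ := by gcongr

/-- Contour shift between two vertical lines. -/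
theorem integral_vertical_eq_of_differentiableOn {h : ℂ → ℂ} {a b : ℝ} (hab : a ≤ b)
    (hd : DifferentiableOn ℂ h (Icc a b ×ℂ univ)) {φ : ℝ → ℝ} {T : ℝ}
    (hφ : Filter.Tendsto φ Filter.atTop (nhds 0))
    (hbd : ∀ σ ∈ Icc a b, ∀ t : ℝ, T ≤ |t| → ‖h (σ + t * I)‖ ≤ φ |t|)
    (ha : Integrable fun t : ℝ => h (a + t * I)) (hb : Integrable fun t : ℝ => h (b + t * I)) :
    ∫ t : ℝ, h (a + t * I) = ∫ t : ℝ, h (b + t * I) := by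
  have ta := intervalIntegral_tendsto_integral ha Filter.tendsto_neg_atTop_atBot Filter.tendsto_id
  have tb := intervalIntegral_tendsto_integral hb Filter.tendsto_neg_atTop_atBot Filter.tendsto_id
  refine (sub_eq_zero.1 (tendsto_nhds_unique (tb.sub ta) ?_)).symm
  refine squeeze_zero_norm' (a := fun R => 2 * (b - a) * φ R) ?_ ?_
  · filter_upwards [Filter.eventually_ge_atTop T, Filter.eventually_ge_atTop 0] with R hR hR0
    have key := integral_boundary_rect_eq_zero_of_differentiableOn h ⟨a, -R⟩ ⟨b, R⟩ (hd.mono (by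
      rw [uIcc_of_le hab]
      exact fun z hz => ⟨hz.1, mem_univ _⟩))
    simp only [smul_eq_mul] at key
    have b1 : ‖∫ x : ℝ in a..b, h (x + (-R : ℝ) * I)‖ ≤ φ R * |b - a| :=
      intervalIntegral.norm_integral_le_of_norm_le_const fun x hx => by
        rw [uIoc_of_le hab] at hx
        simpa [abs_of_nonneg hR0] using hbd x (Ioc_subset_Icc_self hx) (-R) (by simpa [abs_of_nonneg hR0])
    have b2 : ‖∫ x : ℝ in a..b, h (x + (R : ℝ) * I)‖ ≤ φ R * |b - a| :=
      intervalIntegral.norm_integral_le_of_norm_le_const fun x hx => by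
        rw [uIoc_of_le hab] at hx
        simpa [abs_of_nonneg hR0] using hbd x (Ioc_subset_Icc_self hx) R (by simpa [abs_of_nonneg hR0])
    rw [abs_of_nonneg (sub_nonneg.2 hab)] at b1 b2
    have e : I * ((∫ t in (-R)..R, h (b + t * I)) - ∫ t in (-R)..R, h (a + t * I)) =
        (∫ x : ℝ in a..b, h (x + (R : ℝ) * I)) - ∫ x : ℝ in a..b, h (x + (-R : ℝ) * I) := by
      linear_combination key
    have e' := congrArg norm e
    rw [norm_mul, norm_I, one_mul] at e'
    refine e'.le.trans ((norm_sub_le _ _).trans ?_)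
    linarith
  · simpa using hφ.const_mul (2 * (b - a))

theorem integrable_inv_mul_inv {c d : ℝ} (hc : c ≠ 0) (hd : d ≠ 0) :
    Integrable fun t : ℝ => ((c + t * I : ℂ) * (d + t * I))⁻¹ := by
  have hn : ∀ {c : ℝ}, c ≠ 0 → ∀ t : ℝ, (c + t * I : ℂ) ≠ 0 := fun hc t h => hc (by
    simpa using congrArg Complex.re h)
  have hi : ∀ {c : ℝ}, c ≠ 0 → Integrable fun t : ℝ => (c ^ 2 + t ^ 2)⁻¹ := fun {c} hc => by
    have := (integrable_inv_one_add_sq.comp_div hc).const_mul (c ^ 2)⁻¹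
    refine this.congr (Filter.Eventually.of_forall fun t => ?_)
    simp only
    rw [← mul_inv]
    congr 1
    field_simp
  refine ((hi hc).add (hi hd)).mono' ?_ (Filter.Eventually.of_forall fun t => ?_)
  · refine Continuous.aestronglyMeasurable ?_
    exact Continuous.inv₀ (by fun_prop) fun t => mul_ne_zero (hn hc t) (hn hd t)
  · have hs : ∀ c : ℝ, ‖(c + t * I : ℂ)‖ ^ 2 = c ^ 2 + t ^ 2 := fun c => by
      rw [← Complex.normSq_eq_norm_sq, Complex.normSq_add_mul_I]
    rw [norm_inv, norm_mul, Pi.add_apply, ← hs, ← hs, mul_inv, ← inv_pow, ← inv_pow]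
    nlinarith [sq_nonneg (‖(c + t * I : ℂ)‖⁻¹ - ‖(d + t * I : ℂ)‖⁻¹),
      sq_nonneg (‖(c + t * I : ℂ)‖⁻¹), sq_nonneg (‖(d + t * I : ℂ)‖⁻¹)]

theorem integral_inv_mul_inv {c d A : ℝ} (hc : c ≠ 0) (hd : d ≠ 0)
    (ht : Filter.Tendsto (fun t => Real.arctan (t / c) - Real.arctan (t / d)) Filter.atTop (nhds A)) :
    (d - c : ℂ) * ∫ t : ℝ, ((c + t * I : ℂ) * (d + t * I))⁻¹ = 2 * A := by
  have hpos : ∀ {c : ℝ}, c ≠ 0 → ∀ t : ℝ, 0 < c ^ 2 + t ^ 2 := fun hc t => by positivity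
  have hn : ∀ {c : ℝ}, c ≠ 0 → ∀ t : ℝ, (c + t * I : ℂ) ≠ 0 := fun hc t h => hc (by
    simpa using congrArg Complex.re h)
  let L : ℝ → ℝ := fun t => Real.log ((c ^ 2 + t ^ 2) / (d ^ 2 + t ^ 2))
  let B : ℝ → ℝ := fun t => Real.arctan (t / c) - Real.arctan (t / d)
  let F : ℝ → ℂ := fun t => (B t : ℂ) - I / 2 * (L t : ℂ)
  have hL : Filter.Tendsto L Filter.atTop (nhds 0) := by
    rw [← Real.log_one]
    refine Filter.Tendsto.log ?_ one_ne_zero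
    have h1 : Filter.Tendsto (fun t : ℝ => d ^ 2 + t ^ 2) Filter.atTop Filter.atTop :=
      Filter.tendsto_atTop_add_const_left _ _ (Filter.tendsto_pow_atTop two_ne_zero)
    have h2 : Filter.Tendsto (fun t : ℝ => 1 + (c ^ 2 - d ^ 2) / (d ^ 2 + t ^ 2)) Filter.atTop
        (nhds (1 + 0)) := tendsto_const_nhds.add (tendsto_const_nhds.div_atTop h1)
    rw [add_zero] at h2
    refine h2.congr fun t => ?_
    have := (hpos hd t).ne'
    field_simp
    ring
  have hLe : ∀ t, L (-t) = L t := fun t => by simp [L]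
  have hBo : ∀ t, B (-t) = -B t := fun t => by simp [B, neg_div, Real.arctan_neg]; ring
  have hT : Filter.Tendsto F Filter.atTop (nhds ((A : ℂ) - I / 2 * ((0 : ℝ) : ℂ))) :=
    ((Complex.continuous_ofReal.tendsto _).comp ht).sub
      (((Complex.continuous_ofReal.tendsto _).comp hL).const_mul _)
  have hT' : Filter.Tendsto F Filter.atBot (nhds (((-A : ℝ) : ℂ) - I / 2 * ((0 : ℝ) : ℂ))) := by
    have : Filter.Tendsto (fun t => F (- -t)) Filter.atBot
        (nhds (((-A : ℝ) : ℂ) - I / 2 * ((0 : ℝ) : ℂ))) := by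
      have h2 : Filter.Tendsto (fun t => F (-t)) Filter.atTop
        (nhds (((-A : ℝ) : ℂ) - I / 2 * ((0 : ℝ) : ℂ))) := by
        simp only [F, hLe, hBo]
        exact ((Complex.continuous_ofReal.tendsto _).comp ht.neg).sub
          (((Complex.continuous_ofReal.tendsto _).comp hL).const_mul _)
      exact h2.comp Filter.tendsto_neg_atBot_atTop
    simpa using this
  have hD : ∀ t : ℝ, HasDerivAt F ((d - c : ℂ) * ((c + t * I : ℂ) * (d + t * I))⁻¹) t := by
    intro t
    have hq : ∀ c : ℝ, HasDerivAt (fun t : ℝ => c ^ 2 + t ^ 2) (2 * t) t := fun c => by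
      simpa using ((hasDerivAt_id t).pow 2).const_add (c ^ 2)
    have hA : ∀ c : ℝ, HasDerivAt (fun t : ℝ => Real.arctan (t / c)) (1 / (1 + (t / c) ^ 2) * (1 / c)) t :=
      fun c => ((hasDerivAt_id t).div_const c).arctan
    have h1 : HasDerivAt B _ t := (hA c).sub (hA d)
    have h2 : HasDerivAt L _ t := ((hq c).div (hq d) (hpos hd t).ne').log
      (div_pos (hpos hc t) (hpos hd t)).ne'
    have h3 : HasDerivAt F _ t := h1.ofReal_comp.sub (h2.ofReal_comp.const_mul (I / 2))
    convert h3 using 1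
    have n1 := hn hc t
    have n2 := hn hd t
    have m1 : (c ^ 2 + t ^ 2 : ℂ) ≠ 0 := by exact_mod_cast (hpos hc t).ne'
    have m2 : (d ^ 2 + t ^ 2 : ℂ) ≠ 0 := by exact_mod_cast (hpos hd t).ne'
    have f1 : (c ^ 2 + t ^ 2 : ℂ) = (c + t * I) * (c - t * I) := by
      linear_combination (t : ℂ) ^ 2 * I_sq
    have f2 : (d ^ 2 + t ^ 2 : ℂ) = (d + t * I) * (d - t * I) := by
      linear_combination (t : ℂ) ^ 2 * I_sq
    have k1 : (c - t * I : ℂ) ≠ 0 := fun h => m1 (by rw [f1, h, mul_zero])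
    have k2 : (d - t * I : ℂ) ≠ 0 := fun h => m2 (by rw [f2, h, mul_zero])
    have hc' : (c : ℂ) ≠ 0 := by exact_mod_cast hc
    have hd' : (d : ℂ) ≠ 0 := by exact_mod_cast hd
    have g1 : (1 / (1 + ((t : ℂ) / c) ^ 2) * (1 / c)) = c / ((c + t * I) * (c - t * I)) := by
      rw [← f1]; field_simp
    have g2 : (1 / (1 + ((t : ℂ) / d) ^ 2) * (1 / d)) = d / ((d + t * I) * (d - t * I)) := by
      rw [← f2]; field_simp
    simp only [Pi.div_apply]
    push_cast
    rw [g1, g2, f1, f2]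
    field_simp
    ring_nf
  have hint := integral_of_hasDerivAt_of_tendsto hD ((integrable_inv_mul_inv hc hd).const_mul _) hT' hT
  rw [integral_const_mul] at hint
  rw [hint]
  push_cast
  ring

theorem tendsto_arctan_div_of_pos {c : ℝ} (hc : 0 < c) :
    Filter.Tendsto (fun t => Real.arctan (t / c)) Filter.atTop (nhds (π / 2)) :=
  ((Real.tendsto_arctan_atTop).mono_right nhdsWithin_le_nhds).comp
    (Filter.tendsto_id.atTop_div_const hc)

theorem tendsto_arctan_div_of_neg {c : ℝ} (hc : c < 0) :
    Filter.Tendsto (fun t => Real.arctan (t / c)) Filter.atTop (nhds (-(π / 2))) := by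
  refine (tendsto_arctan_div_of_pos (neg_pos.2 hc)).neg.congr fun t => ?_
  rw [div_neg, Real.arctan_neg, neg_neg]

theorem integral_inv_mul_inv_of_pos_of_neg {c d : ℝ} (hc : 0 < c) (hd : d < 0) :
    (d - c : ℂ) * ∫ t : ℝ, ((c + t * I : ℂ) * (d + t * I))⁻¹ = 2 * π := by
  rw [integral_inv_mul_inv hc.ne' hd.ne
    ((tendsto_arctan_div_of_pos hc).sub (tendsto_arctan_div_of_neg hd))]
  push_cast; ring

theorem integral_inv_mul_inv_of_neg_of_neg {c d : ℝ} (hc : c < 0) (hd : d < 0) :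
    (d - c : ℂ) * ∫ t : ℝ, ((c + t * I : ℂ) * (d + t * I))⁻¹ = 0 := by
  rw [integral_inv_mul_inv hc.ne hd.ne
    ((tendsto_arctan_div_of_neg hc).sub (tendsto_arctan_div_of_neg hd))]
  push_cast; ring

/-- Contour shift across a simple pole between two vertical lines. -/
theorem integral_vertical_sub_eq_of_simple_pole {N : ℂ → ℂ} {p : ℂ} {a b : ℝ} (hap : a < p.re)
    (hpb : p.re < b) (hbp : b < p.re + 1) (hN : DifferentiableOn ℂ N (Icc a b ×ℂ univ))
    {φ : ℝ → ℝ} {T : ℝ} (hφ : Filter.Tendsto φ Filter.atTop (nhds 0))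
    (hbd : ∀ σ ∈ Icc a b, ∀ t : ℝ, T ≤ |t| → ‖N (σ + t * I) / (σ + t * I - p)‖ ≤ φ |t|)
    (ha : Integrable fun t : ℝ => N (a + t * I) / (a + t * I - p))
    (hb : Integrable fun t : ℝ => N (b + t * I) / (b + t * I - p)) :
    (∫ t : ℝ, N (b + t * I) / (b + t * I - p)) - ∫ t : ℝ, N (a + t * I) / (a + t * I - p) =
      2 * π * N p := by
  have hS : (Icc a b ×ℂ univ) ∈ nhds p := by
    have : (Ioo a b ×ℂ univ) ∈ nhds p :=
      (isOpen_Ioo.reProdIm isOpen_univ).mem_nhds ⟨⟨hap, hpb⟩, mem_univ _⟩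
    exact Filter.mem_of_superset this fun z hz => ⟨Ioo_subset_Icc_self hz.1, hz.2⟩
  let h : ℂ → ℂ := fun s => dslope N p s + N p * (s - p - 1)⁻¹
  have hh : ∀ s, s ≠ p → s - p - 1 ≠ 0 → h s = N s / (s - p) + N p * ((s - p) * (s - p - 1))⁻¹ := by
    intro s hs hs'
    have : s - p ≠ 0 := sub_ne_zero.2 hs
    simp only [h]
    rw [dslope_of_ne _ hs, slope_def_field]
    field_simp
    ring
  have hd : DifferentiableOn ℂ h (Icc a b ×ℂ univ) := by
    refine ((Complex.differentiableOn_dslope hS).2 hN).add ?_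
    refine DifferentiableOn.const_mul (DifferentiableOn.inv (by fun_prop) fun s hs h0 => ?_) _
    have h1 := hs.1.2
    have := congrArg Complex.re h0
    simp at this
    linarith
  have hline : ∀ c : ℝ, c ≠ p.re → c < p.re + 1 → ∀ t : ℝ, h (c + t * I) =
      N (c + t * I) / (c + t * I - p) + N p * ((((c - p.re : ℝ) : ℂ) + (t - p.im : ℝ) * I) *
        (((c - p.re - 1 : ℝ) : ℂ) + (t - p.im : ℝ) * I))⁻¹ := by
    intro c hc hc1 t
    rw [hh]
    · congr 4
      · apply Complex.ext <;> simp
      · apply Complex.ext <;> simp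
    · intro h'; apply hc; simpa using congrArg Complex.re h'
    · intro h'
      have := congrArg Complex.re h'
      simp at this
      linarith
  have hKi : ∀ c : ℝ, c ≠ p.re → c < p.re + 1 → Integrable fun t : ℝ =>
      N p * ((((c - p.re : ℝ) : ℂ) + (t - p.im : ℝ) * I) *
        (((c - p.re - 1 : ℝ) : ℂ) + (t - p.im : ℝ) * I))⁻¹ := fun c hc hc1 =>
    ((integrable_inv_mul_inv (sub_ne_zero.2 hc) (d := c - p.re - 1)
      (by linarith : c - p.re - 1 < 0).ne).comp_sub_right p.im).const_mul _
  have key := integral_vertical_eq_of_differentiableOn (h := h) (hap.trans hpb).le hd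
    (φ := fun r => φ r + ‖N p‖ * ((r - |p.im|) ^ 2)⁻¹) (T := max T (|p.im| + 1)) ?_ ?_ ?_ ?_
  · simp only [hline a hap.ne (by linarith), hline b hpb.ne' hbp] at key
    rw [integral_add ha (hKi a hap.ne (by linarith)), integral_add hb (hKi b hpb.ne' hbp),
      integral_const_mul, integral_const_mul,
      integral_sub_right_eq_self (fun t : ℝ => ((((a - p.re : ℝ) : ℂ) + t * I) *
        (((a - p.re - 1 : ℝ) : ℂ) + t * I))⁻¹),
      integral_sub_right_eq_self (fun t : ℝ => ((((b - p.re : ℝ) : ℂ) + t * I) *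
        (((b - p.re - 1 : ℝ) : ℂ) + t * I))⁻¹)] at key
    have k1 := integral_inv_mul_inv_of_neg_of_neg (c := a - p.re) (d := a - p.re - 1)
      (by linarith) (by linarith)
    have k2 := integral_inv_mul_inv_of_pos_of_neg (c := b - p.re) (d := b - p.re - 1)
      (by linarith) (by linarith)
    have e : ∀ c : ℝ, (((c - p.re - 1 : ℝ) : ℂ) - ((c - p.re : ℝ) : ℂ)) = -1 := fun c => by
      push_cast; ring
    rw [e] at k1 k2
    linear_combination -key + N p * k2 - N p * k1
  · have h1 : Filter.Tendsto (fun r : ℝ => (r - |p.im|) ^ 2) Filter.atTop Filter.atTop :=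
      (Filter.tendsto_pow_atTop two_ne_zero).comp
        (Filter.tendsto_atTop_add_const_right _ (-|p.im|) Filter.tendsto_id)
    simpa using hφ.add (h1.inv_tendsto_atTop.const_mul ‖N p‖)
  · intro σ hσ t ht
    have ht1 := (le_max_left _ _).trans ht
    have ht2 := (le_max_right _ _).trans ht
    have him : (t - p.im) ≠ 0 := by
      intro h0
      rw [sub_eq_zero.1 h0] at ht2
      linarith
    have hab := abs_sub_abs_le_abs_sub t p.im
    rw [hh]
    · refine (norm_add_le _ _).trans (add_le_add (hbd σ hσ t ht1) ?_)
      rw [norm_mul, norm_inv, norm_mul]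
      gcongr
      · nlinarith
      · rw [sq]
        have n1 := Complex.abs_im_le_norm (σ + t * I - p)
        have n2 := Complex.abs_im_le_norm (σ + t * I - p - 1)
        simp at n1 n2
        gcongr <;> linarith
    · intro h'
      apply him
      have := congrArg Complex.im h'
      simp at this
      linarith
    · intro h'
      apply him
      have := congrArg Complex.im h'
      simpa using this
  · simp only [hline a hap.ne (by linarith)]
    exact ha.add (hKi a hap.ne (by linarith))
  · simp only [hline b hpb.ne' hbp]
    exact hb.add (hKi b hpb.ne' hbp)

theorem integrable_of_continuous_of_norm_le_rpow {f : ℝ → ℂ} (hf : Continuous f) {C T r : ℝ} (hT : 0 < T)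
    (hr : r < -1) (h : ∀ t : ℝ, T ≤ |t| → ‖f t‖ ≤ C * |t| ^ r) : Integrable f := by
  have hi : Integrable (fun t : ℝ => C * t ^ r) (volume.restrict (Ioi T)) :=
    (integrableOn_Ioi_rpow_of_lt hr hT).const_mul C
  have key : ∀ g : ℝ → ℂ, Continuous g → (∀ t : ℝ, T ≤ |t| → ‖g t‖ ≤ C * |t| ^ r) →
      IntegrableOn g (Ioi T) := fun g hg hb => by
    refine hi.mono' hg.aestronglyMeasurable ?_
    filter_upwards [ae_restrict_mem measurableSet_Ioi] with t ht
    have ht0 : 0 < t := hT.trans ht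
    have := hb t (by rw [abs_of_pos ht0]; exact le_of_lt ht)
    rwa [abs_of_pos ht0] at this
  have h1 := key f hf h
  have h2 : IntegrableOn f (Iio (-T)) := by
    have := (key (fun t => f (-t)) (by fun_prop) fun t ht => by simpa using h (-t) (by simpa)).comp_neg
    simpa using this
  have h3 : IntegrableOn f (Icc (-T) T) := hf.continuousOn.integrableOn_Icc
  have := (h2.union h3).union h1
  rwa [Iio_union_Icc_eq_Iic (by linarith), Iic_union_Ioi, integrableOn_univ] at this

theorem barnesKernel_sub_one {ν s : ℂ} (hν : ν.re = 0) (hs : s.re ≤ 1 / 4) :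
    barnesKernel ν (s - 1) =
      barnesKernel ν s * ((1 / 2 - s) / ((s + ν - 1) * (2 - s) * (1 + ν - s))) := by
  have n1 : 1 / 2 - s ≠ 0 := fun h => by
    have := congrArg Complex.re h; norm_num at this; linarith
  have n2 : 2 - s ≠ 0 := fun h => by
    have := congrArg Complex.re h; simp at this; linarith
  have n3 : 1 + ν - s ≠ 0 := fun h => by
    have := congrArg Complex.re h; simp [hν] at this; linarith
  have n4 : s + ν - 1 ≠ 0 := fun h => by
    have := congrArg Complex.re h; simp [hν] at this; linarith
  have e1 := Complex.Gamma_add_one _ n1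
  have e2 := Complex.Gamma_add_one _ n2
  have e3 := Complex.Gamma_add_one _ n3
  have e4 := Complex.Gamma_add_one _ n4
  rw [sub_add_cancel] at e4
  rw [barnesKernel, barnesKernel, (by ring : 1 / 2 - (s - 1) = 1 / 2 - s + 1),
    (by ring : 2 - (s - 1) = 2 - s + 1), (by ring : 1 + ν - (s - 1) = 1 + ν - s + 1),
    (by ring : s - 1 + ν = s + ν - 1), e1, e2, e3, e4]
  have g2 : Complex.Gamma (2 - s) ≠ 0 := Complex.Gamma_ne_zero_of_re_pos (by simp; linarith)
  have g3 : Complex.Gamma (1 + ν - s) ≠ 0 :=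
    Complex.Gamma_ne_zero_of_re_pos (by simp [hν]; linarith)
  field_simp

theorem norm_barnesKernel_sub_natCast_le {ν s : ℂ} (hν : ν.re = 0) (hs : s.re ≤ 1 / 4) (n : ℕ) :
    ‖barnesKernel ν (s - n)‖ ≤ ‖barnesKernel ν s‖ * (4 ^ n / n.factorial) := by
  induction n with
  | zero => simp
  | succ n ih =>
    have hn : (0 : ℝ) ≤ n := by positivity
    set w := s - n with hw
    have hre : w.re = s.re - n := by simp [hw]
    have hwre : w.re ≤ 1 / 4 := by linarith
    have e : s - (n + 1 : ℕ) = w - 1 := by rw [hw]; push_cast; ring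
    rw [e, barnesKernel_sub_one hν hwre, norm_mul]
    have a1 : ‖1 / 2 - w‖ ≤ ‖2 - w‖ := by
      refine abs_le_of_sq_le_sq' ?_ (norm_nonneg _) |>.2
      rw [← Complex.normSq_eq_norm_sq, ← Complex.normSq_eq_norm_sq, Complex.normSq_apply,
        Complex.normSq_apply]
      norm_num
      nlinarith
    have a2 : (n + 1) / 2 ≤ ‖w + ν - 1‖ := by
      have := (neg_le_abs _).trans (Complex.abs_re_le_norm (w + ν - 1))
      simp [hν] at this
      linarith
    have a3 : (n + 1) / 2 ≤ ‖1 + ν - w‖ := by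
      have := Complex.re_le_norm (1 + ν - w)
      simp [hν] at this
      linarith
    have a4 : 0 < ‖2 - w‖ := by
      have := Complex.re_le_norm (2 - w)
      simp at this
      linarith
    have hR : ‖(1 / 2 - w) / ((w + ν - 1) * (2 - w) * (1 + ν - w))‖ ≤ 4 / (n + 1) := by
      have a5 : 0 < ‖w + ν - 1‖ := lt_of_lt_of_le (by positivity) a2
      have a6 : 0 < ‖1 + ν - w‖ := lt_of_lt_of_le (by positivity) a3
      rw [norm_div, norm_mul, norm_mul, div_le_div_iff₀ (by positivity) (by positivity)]
      calc ‖1 / 2 - w‖ * (n + 1 : ℝ) ≤ ‖2 - w‖ * ((n + 1) * (n + 1)) := by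
            gcongr; nlinarith
        _ = 4 * ((n + 1) / 2 * ‖2 - w‖ * ((n + 1) / 2)) := by ring
        _ ≤ _ := by gcongr
    calc _ ≤ ‖barnesKernel ν s‖ * (4 ^ n / n.factorial) * (4 / (n + 1)) := by gcongr
      _ = _ := by
        rw [Nat.factorial_succ, pow_succ]; push_cast; field_simp

theorem Complex.Gamma_add_natCast_eq_mul_prod {z : ℂ} (n : ℕ) (h : ∀ j < n, z + j ≠ 0) :
    Complex.Gamma (z + n) = Complex.Gamma z * ∏ j ∈ Finset.range n, (z + j) := by
  induction n with
  | zero => simp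
  | succ n ih =>
    rw [Finset.prod_range_succ, Nat.cast_succ, ← add_assoc, Complex.Gamma_add_one _ (h n n.lt_succ_self),
      ih fun j hj => h j (hj.trans n.lt_succ_self)]
    ring

/-- The residue of `barnesKernel ν s * x ^ (-s)` at `s = -ν - n`. -/
noncomputable def barnesResidue (ν : ℂ) (x : ℝ) (n : ℕ) : ℂ :=
  (-1) ^ n / n.factorial * Complex.Gamma (1 / 2 + ν + n) /
    (Complex.Gamma (2 + ν + n) * Complex.Gamma (1 + 2 * ν + n)) * (x : ℂ) ^ (ν + n)

theorem continuous_barnesKernel_vertical (τ : ℝ) {σ : ℝ} (h : σ < 1 / 2) (hσ : ∀ n : ℤ, σ ≠ n) :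
    Continuous fun t : ℝ => barnesKernel (I * τ) (σ + t * I) := by
  refine continuous_iff_continuousAt.2 fun t => ?_
  have hΓ : ∀ z : ℂ, (∀ n : ℕ, z ≠ -n) → ContinuousAt Complex.Gamma z :=
    fun z hz => (Complex.differentiableAt_Gamma z hz).continuousAt
  have hpos : ∀ z : ℂ, 0 < z.re → ∀ n : ℕ, z ≠ -n := fun z hz n h => by
    have hn : (0 : ℝ) ≤ n := by positivity
    rw [h] at hz
    simp at hz
    linarith
  have hc : ∀ f : ℝ → ℂ, ContinuousAt f t → (∀ n : ℕ, f t ≠ -n) →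
      ContinuousAt (fun t => Complex.Gamma (f t)) t := fun f hf hn =>
    ContinuousAt.comp (g := Complex.Gamma) (hΓ _ hn) hf
  refine ContinuousAt.div (ContinuousAt.mul (hc _ (by fun_prop) ?_) (hc _ (by fun_prop) ?_))
    (ContinuousAt.mul (hc _ (by fun_prop) ?_) (hc _ (by fun_prop) ?_)) (mul_ne_zero ?_ ?_)
  · intro n hn
    apply hσ (-n)
    have := congrArg Complex.re hn
    simpa using this
  · exact hpos _ (by norm_num; linarith)
  · exact hpos _ (by simp; linarith)
  · exact hpos _ (by simp; linarith)
  · exact Complex.Gamma_ne_zero_of_re_pos (by simp; linarith)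
  · exact Complex.Gamma_ne_zero_of_re_pos (by simp; linarith)

theorem norm_cpow_neg_vertical {x : ℝ} (hx : 0 < x) (σ t : ℝ) :
    ‖(x : ℂ) ^ (-((σ : ℂ) + t * I))‖ = x ^ (-σ) := by
  rw [Complex.norm_cpow_eq_rpow_re_of_pos hx]
  simp

theorem continuous_cpow_neg_vertical {x : ℝ} (hx : 0 < x) (σ : ℝ) :
    Continuous fun t : ℝ => (x : ℂ) ^ (-((σ : ℂ) + t * I)) := by
  refine Continuous.const_cpow (by fun_prop) (Or.inl ?_)
  exact_mod_cast hx.ne'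

theorem exists_norm_barnesKernel_le_of_natCast (τ : ℝ) {γ : ℝ} (hγ : 0 < γ) (hγ' : γ < 1 / 4) (n : ℕ) :
    ∃ C, ∀ σ ∈ Icc (γ - n - 1) (γ - n), ∀ t : ℝ, 1 + |τ| ≤ |t| →
      ‖barnesKernel (I * τ) (σ + t * I)‖ ≤ C * |t| ^ (-(3 / 2) : ℝ) := by
  obtain ⟨C, hC⟩ := exists_norm_barnesKernel_le τ (a := γ - 1) (b := γ) (by linarith) (by linarith)
  refine ⟨C * (4 ^ n / n.factorial), fun σ hσ t ht => ?_⟩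
  have h1 := hC (σ + n) ⟨by linarith [hσ.1], by linarith [hσ.2]⟩ t ht
  have h2 := norm_barnesKernel_sub_natCast_le (ν := I * τ) (s := ((σ + n : ℝ) : ℂ) + t * I) (by simp)
    (by simp; linarith [hσ.2]) n
  have e : ((σ + n : ℝ) : ℂ) + t * I - n = σ + t * I := by push_cast; ring
  rw [e] at h2
  refine h2.trans ((mul_le_mul_of_nonneg_right h1 (by positivity)).trans_eq (by ring))

theorem integrable_barnesKernel_vertical (τ : ℝ) {γ : ℝ} (hγ : 0 < γ) (hγ' : γ < 1 / 4) (n : ℕ) :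
    Integrable fun t : ℝ => barnesKernel (I * τ) ((γ - n : ℝ) + t * I) := by
  obtain ⟨C, hC⟩ := exists_norm_barnesKernel_le_of_natCast τ hγ hγ' n
  have hn : (0 : ℝ) ≤ n := by positivity
  refine integrable_of_continuous_of_norm_le_rpow (continuous_barnesKernel_vertical τ (by linarith) ?_)
    (T := 1 + |τ|) (by positivity) (by norm_num) (hC (γ - n) ⟨by linarith, le_rfl⟩)
  intro m hm
  have h1 : ((m + n : ℤ) : ℝ) = γ := by push_cast; linarith
  rw [← h1] at hγ hγ'
  have h2 : (0 : ℤ) < m + n := by exact_mod_cast hγ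
  have h3 : ((m + n : ℤ) : ℝ) < 1 := by linarith
  have h4 : (m + n : ℤ) < 1 := by exact_mod_cast h3
  omega

theorem integrable_barnesKernel_mul_cpow_vertical (τ : ℝ) {γ x : ℝ} (hx : 0 < x) (hγ : 0 < γ)
    (hγ' : γ < 1 / 4) (n : ℕ) :
    Integrable fun t : ℝ => barnesKernel (I * τ) ((γ - n : ℝ) + t * I) *
      (x : ℂ) ^ (-(((γ - n : ℝ) : ℂ) + t * I)) :=
  (integrable_barnesKernel_vertical τ hγ hγ' n).mul_bdd
    (continuous_cpow_neg_vertical hx _).aestronglyMeasurable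
    (Filter.Eventually.of_forall fun t => (norm_cpow_neg_vertical hx _ t).le)

theorem integral_barnesKernel_sub_integral (τ : ℝ) {γ x : ℝ} (hx : 0 < x) (hγ : 0 < γ)
    (hγ' : γ < 1 / 4) (n : ℕ) :
    (∫ t : ℝ, barnesKernel (I * τ) ((γ - n : ℝ) + t * I) * (x : ℂ) ^ (-(((γ - n : ℝ) : ℂ) + t * I))) -
      ∫ t : ℝ, barnesKernel (I * τ) ((γ - (n + 1 : ℕ) : ℝ) + t * I) *
        (x : ℂ) ^ (-(((γ - (n + 1 : ℕ) : ℝ) : ℂ) + t * I)) =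
      2 * π * barnesResidue (I * τ) x n := by
  set ν : ℂ := I * τ with hν
  have hνre : ν.re = 0 := by simp [hν]
  let N : ℂ → ℂ := fun s => Complex.Gamma (s + ν + (n + 1 : ℕ)) / (∏ j ∈ Finset.range n, (s + ν + j)) *
    Complex.Gamma (1 / 2 - s) / (Complex.Gamma (2 - s) * Complex.Gamma (1 + ν - s)) * (x : ℂ) ^ (-s)
  have hn : (0 : ℝ) ≤ n := by positivity
  have hF : ∀ s : ℂ, (∀ j : ℕ, s + ν + j ≠ 0) →
      N s / (s - (-ν - n)) = barnesKernel ν s * (x : ℂ) ^ (-s) := by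
    intro s hs
    have h1 := Complex.Gamma_add_natCast_eq_mul_prod (z := s + ν) (n + 1) fun j _ => hs j
    rw [Finset.prod_range_succ] at h1
    have h2 : ∏ j ∈ Finset.range n, (s + ν + j) ≠ 0 := Finset.prod_ne_zero_iff.2 fun j _ => hs j
    have h3 := hs n
    have e : s - (-ν - n) = s + ν + n := by ring
    simp only [N]
    rw [h1, e, barnesKernel]
    field_simp
  have hline : ∀ m : ℕ, ∀ (t : ℝ) (j : ℕ), ((γ - m : ℝ) : ℂ) + t * I + ν + j ≠ 0 := by
    intro m t j h
    have h0 := congrArg Complex.re h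
    simp [hνre] at h0
    have h1 : ((m - j : ℤ) : ℝ) = γ := by push_cast; linarith
    rw [← h1] at hγ hγ'
    have h2 : (0 : ℤ) < m - j := by exact_mod_cast hγ
    have h3 : ((m - j : ℤ) : ℝ) < 1 := by linarith
    have h4 : (m - j : ℤ) < 1 := by exact_mod_cast h3
    omega
  have hp : N (-ν - n) = barnesResidue ν x n := by
    have h2 : ∏ j ∈ Finset.range n, (-ν - n + ν + j) = (-1 : ℂ) ^ n * n.factorial := by
      rw [← Finset.prod_range_reflect]
      have : ∀ j ∈ Finset.range n, (-ν - n + ν + ((n - 1 - j : ℕ) : ℂ)) = (-1) * ((j + 1 : ℕ) : ℂ) := by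
        intro j hj
        have hj' := Finset.mem_range.1 hj
        have : (((n - 1 - j : ℕ) + (j + 1) : ℕ) : ℂ) = n := by congr 1; omega
        push_cast at this ⊢
        linear_combination this
      rw [Finset.prod_congr rfl this, Finset.prod_mul_distrib, Finset.prod_const, Finset.card_range,
        ← Nat.cast_prod, Finset.prod_range_add_one_eq_factorial]
    simp only [N]
    rw [h2, barnesResidue, (by push_cast; ring : -ν - n + ν + (n + 1 : ℕ) = 1), Complex.Gamma_one,
      (by ring : 1 / 2 - (-ν - n) = 1 / 2 + ν + n), (by ring : 2 - (-ν - n) = 2 + ν + n),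
      (by ring : 1 + ν - (-ν - n) = 1 + 2 * ν + n), (by ring : -(-ν - (n : ℂ)) = ν + n), one_div, mul_inv,
      ← inv_pow, inv_neg, inv_one]
    ring
  obtain ⟨C, hC⟩ := exists_norm_barnesKernel_le_of_natCast τ hγ hγ' n
  have hxc : ContinuousOn (fun σ : ℝ => x ^ (-σ)) (Icc (γ - n - 1) (γ - n)) := by
    refine Continuous.continuousOn ?_
    exact Continuous.rpow continuous_const continuous_neg fun σ => Or.inl hx.ne'
  obtain ⟨M, hM⟩ := isCompact_Icc.exists_bound_of_continuousOn hxc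
  have eb : γ - ((n + 1 : ℕ) : ℝ) = γ - n - 1 := by push_cast; ring
  have key := integral_vertical_sub_eq_of_simple_pole (N := N) (p := -ν - n) (a := γ - (n + 1 : ℕ))
    (b := γ - n) (by simp [hνre]; linarith) (by simp [hνre]; linarith) (by simp [hνre]; linarith) ?_
    (φ := fun r => C * r ^ (-(3 / 2) : ℝ) * M) (T := 1 + |τ|) ?_ ?_ ?_ ?_
  · rw [hp] at key
    rw [← key]
    congr 1 <;> congr 1 <;> ext t
    · rw [hF _ (hline n t)]
    · rw [hF _ (hline (n + 1) t)]
  · intro s hs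
    rw [eb] at hs
    have hs1 : γ - n - 1 ≤ s.re := hs.1.1
    have hs2 : s.re ≤ γ - n := hs.1.2
    have hΓ : ∀ z : ℂ, 0 < z.re → DifferentiableAt ℂ Complex.Gamma z := fun z hz =>
      Complex.differentiableAt_Gamma z fun m h => by
        have hm : (0 : ℝ) ≤ m := by positivity
        rw [h] at hz
        simp at hz
        linarith
    have hc : ∀ f : ℂ → ℂ, DifferentiableAt ℂ f s → 0 < (f s).re →
        DifferentiableAt ℂ (fun s => Complex.Gamma (f s)) s := fun f hf h =>
      DifferentiableAt.comp (g := Complex.Gamma) s (hΓ _ h) hf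
    refine DifferentiableAt.differentiableWithinAt ?_
    refine DifferentiableAt.mul (DifferentiableAt.div (DifferentiableAt.mul (DifferentiableAt.div
      (hc _ (by fun_prop) ?_) (by fun_prop) ?_) (hc _ (by fun_prop) ?_)) (DifferentiableAt.mul
      (hc _ (by fun_prop) ?_) (hc _ (by fun_prop) ?_)) (mul_ne_zero ?_ ?_)) ?_
    · simp [hνre]; linarith
    · refine Finset.prod_ne_zero_iff.2 fun j hj h => ?_
      have hj' : ((j + 1 : ℕ) : ℝ) ≤ n := by exact_mod_cast Finset.mem_range.1 hj
      push_cast at hj'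
      have := congrArg Complex.re h
      simp [hνre] at this
      linarith
    · norm_num; linarith
    · simp; linarith
    · simp [hνre]; linarith
    · exact Complex.Gamma_ne_zero_of_re_pos (by simp; linarith)
    · exact Complex.Gamma_ne_zero_of_re_pos (by simp [hνre]; linarith)
    · exact DifferentiableAt.const_cpow (by fun_prop) (Or.inl (by exact_mod_cast hx.ne'))
  · have := ((tendsto_rpow_neg_atTop (y := 3 / 2) (by norm_num)).const_mul C).mul_const M
    simpa using this
  · intro σ hσ t ht
    rw [eb] at hσ
    have ht0 : t ≠ 0 := by
      rintro rfl
      rw [abs_zero] at ht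
      linarith [abs_nonneg τ]
    rw [hF, norm_mul, norm_cpow_neg_vertical hx]
    · have h1 := hC σ hσ t ht
      refine mul_le_mul h1 ((le_abs_self _).trans (hM σ hσ)) (by positivity) ((norm_nonneg _).trans h1)
    · intro j h
      have := congrArg Complex.im h
      simp [hν] at this
      have h2 : t = -τ := by linarith
      rw [h2, abs_neg] at ht
      linarith
  · simp only [hF _ (hline _ _)]
    exact integrable_barnesKernel_mul_cpow_vertical τ hx hγ hγ' (n + 1)
  · simp only [hF _ (hline _ _)]
    exact integrable_barnesKernel_mul_cpow_vertical τ hx hγ hγ' n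

theorem tendsto_sum_barnesResidue (τ : ℝ) {γ x : ℝ} (hx : 0 < x) (hγ : 0 < γ) (hγ' : γ < 1 / 4) :
    Filter.Tendsto (fun n => 2 * π * ∑ k ∈ Finset.range n, barnesResidue (I * τ) x k) Filter.atTop
      (nhds (∫ t : ℝ, barnesKernel (I * τ) (γ + t * I) * (x : ℂ) ^ (-((γ : ℂ) + t * I)))) := by
  let L : ℕ → ℂ := fun n => ∫ t : ℝ, barnesKernel (I * τ) ((γ - n : ℝ) + t * I) *
    (x : ℂ) ^ (-(((γ - n : ℝ) : ℂ) + t * I))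
  have h0 : (∫ t : ℝ, barnesKernel (I * τ) (γ + t * I) * (x : ℂ) ^ (-((γ : ℂ) + t * I))) = L 0 := by
    simp [L]
  have hsum : ∀ n, 2 * π * ∑ k ∈ Finset.range n, barnesResidue (I * τ) x k = L 0 - L n := by
    intro n
    rw [← Finset.sum_range_sub', Finset.mul_sum]
    exact Finset.sum_congr rfl fun k _ => (integral_barnesKernel_sub_integral τ hx hγ hγ' k).symm
  have hL : Filter.Tendsto L Filter.atTop (nhds 0) := by
    let J : ℝ := ∫ t : ℝ, ‖barnesKernel (I * τ) (γ + t * I)‖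
    refine squeeze_zero_norm (a := fun n => x ^ (-γ) * J * ((4 * x) ^ n / n.factorial)) (fun n => ?_) ?_
    · have hi : Integrable fun t : ℝ => barnesKernel (I * τ) (γ + t * I) := by
        simpa using integrable_barnesKernel_vertical τ hγ hγ' 0
      refine (norm_integral_le_of_norm_le (hi.norm.mul_const (4 ^ n / n.factorial * x ^ (-(γ - n))))
        (Filter.Eventually.of_forall fun t => ?_)).trans_eq ?_
      · rw [norm_mul, norm_cpow_neg_vertical hx, ← mul_assoc]
        refine mul_le_mul_of_nonneg_right ?_ (by positivity)
        have := norm_barnesKernel_sub_natCast_le (ν := I * τ) (s := (γ : ℂ) + t * I) (by simp)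
          (by simpa using hγ'.le.trans_eq (by norm_num)) n
        have e : ((γ - n : ℝ) : ℂ) + t * I = γ + t * I - n := by push_cast; ring
        rwa [e]
      · rw [integral_mul_const, neg_sub, sub_eq_add_neg, Real.rpow_add hx, Real.rpow_natCast, mul_pow]
        ring
    · simpa using (FloorSemiring.tendsto_pow_div_factorial_atTop (4 * x)).const_mul (x ^ (-γ) * J)
  rw [h0]
  simp only [hsum]
  simpa using hL.const_sub (L 0)

theorem Ring.choose_eq_Gamma_div {w : ℂ} {k : ℕ} (h : 0 < (w - k + 1).re) :
    Ring.choose w k = Complex.Gamma (w + 1) / (k.factorial * Complex.Gamma (w - k + 1)) := by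
  have hne : ∀ j < k, w - k + 1 + (j : ℂ) ≠ 0 := fun j _ h0 => by
    have := congrArg Complex.re h0
    rw [Complex.add_re, Complex.natCast_re, Complex.zero_re] at this
    have : (0 : ℝ) ≤ j := by positivity
    linarith
  have hΓ := Complex.Gamma_add_natCast_eq_mul_prod k hne
  have hΓ0 := Complex.Gamma_ne_zero_of_re_pos h
  have hprod : ∀ (z : ℂ) (m : ℕ), (ascPochhammer ℂ m).eval z = ∏ j ∈ Finset.range m, (z + j) := by
    intro z m
    induction m with
    | zero => simp
    | succ m ih => rw [ascPochhammer_succ_eval, ih, Finset.prod_range_succ]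
  rw [Ring.choose_eq_smul, Polynomial.descPochhammer_smeval_eq_ascPochhammer,
    Polynomial.ascPochhammer_smeval_eq_eval, hprod, smul_eq_mul,
    show w + 1 = w - k + 1 + k by ring, hΓ]
  have : (k.factorial : ℂ) ≠ 0 := by exact_mod_cast k.factorial_ne_zero
  field_simp

theorem sum_antidiagonal_inv_Gamma {ν : ℂ} (hν : ν.re = 0) (n : ℕ) :
    ∑ p ∈ Finset.HasAntidiagonal.antidiagonal n, 1 / ((p.1.factorial : ℂ) * Complex.Gamma (p.1 + ν + 1)) *
        (1 / ((p.2.factorial : ℂ) * Complex.Gamma (p.2 + ν + 1))) =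
      Complex.Gamma (2 * (ν + n) + 1) / (n.factorial * Complex.Gamma (ν + n + 1) ^ 2 *
        Complex.Gamma (2 * ν + n + 1)) := by
  have hw0 : Complex.Gamma (ν + n + 1) ≠ 0 := Complex.Gamma_ne_zero_of_re_pos (by
    simp [hν]; positivity)
  have key := Ring.add_choose_eq n (Commute.all (ν + n) (ν + n))
  rw [← two_mul, Ring.choose_eq_Gamma_div (by simp [hν]; linarith [n.cast_nonneg (α := ℝ)])] at key
  have e : 2 * (ν + n) - n + 1 = 2 * ν + n + 1 := by ring
  rw [e] at key
  have hsum : ∑ p ∈ Finset.HasAntidiagonal.antidiagonal n, Ring.choose (ν + n) p.1 * Ring.choose (ν + n) p.2 =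
      Complex.Gamma (ν + n + 1) ^ 2 * ∑ p ∈ Finset.HasAntidiagonal.antidiagonal n,
        1 / ((p.1.factorial : ℂ) * Complex.Gamma (p.1 + ν + 1)) *
        (1 / ((p.2.factorial : ℂ) * Complex.Gamma (p.2 + ν + 1))) := by
    rw [Finset.mul_sum]
    refine Finset.sum_congr rfl fun p hp => ?_
    have hp' : (p.1 : ℂ) + p.2 = n := by exact_mod_cast Finset.HasAntidiagonal.mem_antidiagonal.1 hp
    have e1 : ν + n - p.1 + 1 = p.2 + ν + 1 := by rw [← hp']; ring
    have e2 : ν + n - p.2 + 1 = p.1 + ν + 1 := by rw [← hp']; ring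
    rw [Ring.choose_eq_Gamma_div (by rw [e1]; simp [hν]; positivity),
      Ring.choose_eq_Gamma_div (by rw [e2]; simp [hν]; positivity), e1, e2]
    ring
  rw [hsum] at key
  rw [← mul_right_inj' (pow_ne_zero 2 hw0), ← key]
  field_simp

theorem Complex.Gamma_two_mul_add_one (w : ℂ) :
    Complex.Gamma (2 * w + 1) * (√π : ℝ) =
      4 ^ w * (Complex.Gamma (1 / 2 + w) * Complex.Gamma (w + 1)) := by
  have h := Complex.Gamma_mul_Gamma_add_half (w + 1 / 2)
  have e1 : w + 1 / 2 + 1 / 2 = w + 1 := by ring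
  have e2 : 2 * (w + 1 / 2) = 2 * w + 1 := by ring
  have e3 : 1 - (2 * w + 1) = -(2 * w) := by ring
  have e4 : (4 : ℂ) ^ w = 2 ^ (2 * w) := by
    rw [Complex.cpow_ofNat_mul, show (4 : ℂ) = ((2 : ℝ) : ℂ) * ((2 : ℝ) : ℂ) by norm_num,
      Complex.mul_cpow_ofReal_nonneg (by norm_num) (by norm_num), sq]
    norm_num
  rw [e1, e2, e3] at h
  rw [add_comm (1 / 2) w, h, e4]
  have : (2 : ℂ) ^ (2 * w) ≠ 0 := by simp [Complex.cpow_eq_zero_iff]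
  rw [Complex.cpow_neg]
  field_simp

/-- The `k`-th term of the series defining `besselJ ν z`. -/
noncomputable def besselJTerm (ν z : ℂ) (k : ℕ) : ℂ :=
  ((-1 : ℂ) ^ k * (z / 2) ^ (2 * (k : ℂ) + ν)) /
    ((k.factorial : ℂ) * Complex.Gamma ((k : ℂ) + ν + 1))

theorem Complex.norm_Gamma_add_one_le {ν : ℂ} (hν : ν.re = 0) (k : ℕ) :
    ‖Complex.Gamma (ν + 1)‖ ≤ ‖Complex.Gamma (k + ν + 1)‖ := by
  induction k with
  | zero => simp
  | succ k ih =>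
    have h1 : (1 : ℝ) ≤ ‖(k : ℂ) + ν + 1‖ := by
      refine le_trans ?_ (Complex.re_le_norm _)
      simp [hν]
    have h0 : (k : ℂ) + ν + 1 ≠ 0 := by
      rw [← norm_pos_iff]; linarith
    have : ((k + 1 : ℕ) : ℂ) + ν + 1 = (k + ν + 1) + 1 := by push_cast; ring
    rw [this, Complex.Gamma_add_one _ h0, norm_mul]
    nlinarith [norm_nonneg (Complex.Gamma ((k : ℂ) + ν + 1))]

theorem summable_norm_besselJTerm {ν : ℂ} (hν : ν.re = 0) {q : ℝ} (hq : 0 < q) :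
    Summable fun k => ‖besselJTerm ν q k‖ := by
  have hΓ : 0 < ‖Complex.Gamma (ν + 1)‖ :=
    norm_pos_iff.2 (Complex.Gamma_ne_zero_of_re_pos (by simp [hν]))
  refine Summable.of_nonneg_of_le (fun _ => norm_nonneg _) (fun k => ?_)
    ((Real.summable_pow_div_factorial ((q / 2) ^ 2)).mul_right ‖Complex.Gamma (ν + 1)‖⁻¹)
  have e : ‖((q : ℂ) / 2) ^ (2 * (k : ℂ) + ν)‖ = ((q / 2) ^ 2) ^ k := by
    have : (q : ℂ) / 2 = ((q / 2 : ℝ) : ℂ) := by push_cast; ring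
    rw [this, Complex.norm_cpow_eq_rpow_re_of_pos (by positivity), ← pow_mul, ← Real.rpow_natCast]
    congr 1
    simp [hν]
  rw [besselJTerm, norm_div, norm_mul, norm_mul, norm_pow, norm_neg, norm_one, one_pow, one_mul, e,
    RCLike.norm_natCast, ← div_eq_mul_inv, ← div_div]
  gcongr
  exact Complex.norm_Gamma_add_one_le hν k

/-- The coefficient of `y ^ (ν + n)` in the expansion of `√π * J_ν(√y) ^ 2`. -/
noncomputable def besselJSqCoeff (ν : ℂ) (n : ℕ) : ℂ :=
  (-1) ^ n / n.factorial * Complex.Gamma (1 / 2 + ν + n) /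
    (Complex.Gamma (1 + ν + n) * Complex.Gamma (1 + 2 * ν + n))

theorem sum_antidiagonal_besselJTerm {ν : ℂ} (hν : ν.re = 0) {y : ℝ} (hy : 0 < y) (n : ℕ) :
    ∑ p ∈ Finset.HasAntidiagonal.antidiagonal n, besselJTerm ν (√y : ℝ) p.1 * besselJTerm ν (√y : ℝ) p.2 =
      ((√π : ℝ) : ℂ)⁻¹ * (besselJSqCoeff ν n * (y : ℂ) ^ (ν + n)) := by
  have hsy : 0 < √y := Real.sqrt_pos.2 hy
  have hq : ((√y : ℝ) : ℂ) / 2 ≠ 0 := by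
    have : ((√y : ℝ) : ℂ) ≠ 0 := by exact_mod_cast hsy.ne'
    simpa using this
  have hcpow : (((√y : ℝ) : ℂ) / 2) ^ (2 * (ν + n)) = (y : ℂ) ^ (ν + n) / 4 ^ (ν + n) := by
    have e1 : ((√y : ℝ) : ℂ) / 2 = ((√y / 2 : ℝ) : ℂ) := by push_cast; ring
    have e2 : (y : ℂ) = ((√y / 2 * (√y / 2) : ℝ) : ℂ) * ((4 : ℝ) : ℂ) := by
      rw [← Complex.ofReal_mul]
      congr 1
      nlinarith [Real.mul_self_sqrt hy.le]
    rw [e2, Complex.mul_cpow_ofReal_nonneg (by positivity) (by norm_num), e1, Complex.ofReal_mul,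
      Complex.mul_cpow_ofReal_nonneg (by positivity) (by positivity), two_mul, Complex.cpow_add]
    · have : ((4 : ℝ) : ℂ) = 4 := by norm_num
      rw [this, mul_div_assoc, div_self, mul_one]
      simp [Complex.cpow_eq_zero_iff]
    · rw [← e1]; exact hq
  have hterm : ∀ p ∈ Finset.HasAntidiagonal.antidiagonal n, besselJTerm ν (√y : ℝ) p.1 *
      besselJTerm ν (√y : ℝ) p.2 = (-1) ^ n * ((y : ℂ) ^ (ν + n) / 4 ^ (ν + n)) *
      (1 / ((p.1.factorial : ℂ) * Complex.Gamma (p.1 + ν + 1)) *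
        (1 / ((p.2.factorial : ℂ) * Complex.Gamma (p.2 + ν + 1)))) := by
    intro p hp
    have hp1 := Finset.HasAntidiagonal.mem_antidiagonal.1 hp
    have hp' : (p.1 : ℂ) + p.2 = n := by exact_mod_cast hp1
    rw [← hcpow, ← hp', ← hp1, pow_add,
      show 2 * (ν + ((p.1 : ℂ) + p.2)) = (2 * p.1 + ν) + (2 * p.2 + ν) by ring,
      Complex.cpow_add _ _ hq, besselJTerm, besselJTerm]
    ring
  have hw0 : Complex.Gamma (ν + n + 1) ≠ 0 := Complex.Gamma_ne_zero_of_re_pos (by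
    simp [hν]; positivity)
  have hw1 : Complex.Gamma (2 * ν + n + 1) ≠ 0 := Complex.Gamma_ne_zero_of_re_pos (by
    simp [hν]; positivity)
  have h4 : (4 : ℂ) ^ (ν + n) ≠ 0 := by simp [Complex.cpow_eq_zero_iff]
  have hpi : ((√π : ℝ) : ℂ) ≠ 0 := by exact_mod_cast (Real.sqrt_pos.2 Real.pi_pos).ne'
  have hn : (n.factorial : ℂ) ≠ 0 := by exact_mod_cast n.factorial_ne_zero
  have hdup := Complex.Gamma_two_mul_add_one (ν + n)
  rw [Finset.sum_congr rfl hterm, ← Finset.mul_sum, sum_antidiagonal_inv_Gamma hν, besselJSqCoeff,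
    show 1 + ν + (n : ℂ) = ν + n + 1 by ring, show 1 + 2 * ν + (n : ℂ) = 2 * ν + n + 1 by ring,
    show 1 / 2 + ν + (n : ℂ) = 1 / 2 + (ν + n) by ring, eq_div_of_mul_eq hpi hdup]
  generalize Complex.Gamma (ν + n + 1) = A at *
  generalize Complex.Gamma (2 * ν + n + 1) = B at *
  generalize (4 : ℂ) ^ (ν + n) = F at *
  generalize (y : ℂ) ^ (ν + n) = Y at *
  generalize Complex.Gamma (1 / 2 + (ν + n)) = D at *
  field_simp

theorem hasSum_besselJ_sq {ν : ℂ} (hν : ν.re = 0) {y : ℝ} (hy : 0 < y) :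
    HasSum (fun n => besselJSqCoeff ν n * (y : ℂ) ^ (ν + n)) ((√π : ℝ) * besselJ ν (√y : ℝ) ^ 2) ∧
      Summable fun n => ‖besselJSqCoeff ν n‖ * y ^ n := by
  have hpi : ((√π : ℝ) : ℂ) ≠ 0 := by exact_mod_cast (Real.sqrt_pos.2 Real.pi_pos).ne'
  have hs := summable_norm_besselJTerm hν (Real.sqrt_pos.2 hy)
  have h1 := tsum_mul_tsum_eq_tsum_sum_antidiagonal_of_summable_norm hs hs
  have h2 := summable_norm_sum_mul_antidiagonal_of_summable_norm hs hs
  simp only [sum_antidiagonal_besselJTerm hν hy] at h1 h2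
  have h3 : Summable fun n => ‖besselJSqCoeff ν n * (y : ℂ) ^ (ν + n)‖ := by
    refine (h2.mul_left ‖((√π : ℝ) : ℂ)‖).congr fun n => ?_
    rw [← norm_mul, mul_inv_cancel_left₀ hpi]
  refine ⟨?_, h3.congr fun n => ?_⟩
  · have h4 := h3.of_norm.hasSum
    rw [tsum_mul_left] at h1
    have : besselJ ν (√y : ℝ) ^ 2 = (∑' k, besselJTerm ν (√y : ℝ) k) *
        ∑' k, besselJTerm ν (√y : ℝ) k := by rw [sq]; rfl
    rwa [this, h1, mul_inv_cancel_left₀ hpi]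
  · rw [norm_mul, Complex.norm_cpow_eq_rpow_re_of_pos hy]
    simp [hν]

theorem integral_Ioo_besselJSqCoeff_mul_cpow {ν : ℂ} (hν : ν.re = 0) {x : ℝ} (hx : 0 < x) (n : ℕ) :
    ∫ y in Ioo 0 x, besselJSqCoeff ν n * (y : ℂ) ^ (ν + n) = x * barnesResidue ν x n := by
  have hne : (1 + ν + n : ℂ) ≠ 0 := fun h => by
    have := congrArg Complex.re h
    simp [hν] at this
    linarith [n.cast_nonneg (α := ℝ)]
  have hxC : (x : ℂ) ≠ 0 := by exact_mod_cast hx.ne'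
  rw [← integral_Ioc_eq_integral_Ioo, ← intervalIntegral.integral_of_le hx.le,
    intervalIntegral.integral_const_mul, integral_cpow (Or.inl (by
      simp [hν]; linarith [n.cast_nonneg (α := ℝ)])),
    show ν + n + 1 = 1 + ν + n by ring, Complex.ofReal_zero, Complex.zero_cpow hne, sub_zero,
    barnesResidue, besselJSqCoeff, show 2 + ν + (n : ℂ) = (1 + ν + n) + 1 by ring,
    Complex.Gamma_add_one _ hne, show (x : ℂ) ^ (1 + ν + n) = x * x ^ (ν + n) by
      rw [show 1 + ν + (n : ℂ) = 1 + (ν + n) by ring, Complex.cpow_add _ _ hxC, Complex.cpow_one]]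
  field_simp

theorem integrableOn_besselJSqCoeff_mul_cpow {ν : ℂ} (hν : ν.re = 0) {x : ℝ} (hx : 0 < x) (n : ℕ) :
    IntegrableOn (fun y : ℝ => besselJSqCoeff ν n * (y : ℂ) ^ (ν + n)) (Ioo 0 x) := by
  refine Integrable.const_mul ?_ _
  have := intervalIntegral.intervalIntegrable_cpow' (a := 0) (b := x) (r := ν + n)
    (by simp [hν]; linarith [n.cast_nonneg (α := ℝ)])
  rwa [intervalIntegrable_iff_integrableOn_Ioo_of_le hx.le] at this

theorem integral_Ioo_besselJ_sq {ν : ℂ} (hν : ν.re = 0) {x : ℝ} (hx : 0 < x) :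
    HasSum (fun n => x * barnesResidue ν x n)
      ((√π : ℝ) * ∫ y in Ioo 0 x, besselJ ν (√y : ℝ) ^ 2) := by
  have hnorm : ∀ n : ℕ, ∀ y ∈ Ioo 0 x, ‖besselJSqCoeff ν n * (y : ℂ) ^ (ν + n)‖ =
      ‖besselJSqCoeff ν n‖ * y ^ n := by
    intro n y hy
    rw [norm_mul, Complex.norm_cpow_eq_rpow_re_of_pos hy.1]
    simp [hν]
  have hint := integrableOn_besselJSqCoeff_mul_cpow hν hx
  have hsum : Summable fun n => ∫ y in Ioo 0 x, ‖besselJSqCoeff ν n * (y : ℂ) ^ (ν + n)‖ := by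
    refine Summable.of_nonneg_of_le (fun n => integral_nonneg fun _ => norm_nonneg _) (fun n => ?_)
      ((hasSum_besselJ_sq hν hx).2.mul_right x)
    have h := norm_setIntegral_le_of_norm_le_const (μ := volume) (s := Ioo 0 x)
      (f := fun y : ℝ => ‖besselJSqCoeff ν n * (y : ℂ) ^ (ν + n)‖)
      (C := ‖besselJSqCoeff ν n‖ * x ^ n) (by simp) (fun y hy => by
        rw [norm_norm, hnorm n y hy]
        have := hy.1.le
        have := hy.2.le
        gcongr)
    refine (Real.le_norm_self _).trans (h.trans_eq ?_)
    simp [hx.le]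
  have key := hasSum_integral_of_summable_integral_norm hint hsum
  simp only [integral_Ioo_besselJSqCoeff_mul_cpow hν hx] at key
  rwa [setIntegral_congr_fun measurableSet_Ioo fun y hy => (hasSum_besselJ_sq hν hy.1).1.tsum_eq,
    integral_const_mul] at key

theorem besselJ_conj (ν : ℂ) {q : ℝ} (hq : 0 < q) :
    besselJ (starRingEnd ℂ ν) q = starRingEnd ℂ (besselJ ν q) := by
  rw [besselJ, besselJ, Complex.conj_tsum]
  refine tsum_congr fun k => ?_
  have h : ((q : ℂ) / 2).arg ≠ π := by
    rw [show (q : ℂ) / 2 = ((q / 2 : ℝ) : ℂ) by push_cast; rfl, Complex.arg_ofReal_of_nonneg (by positivity)]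
    exact Real.pi_pos.ne
  have h2 := Complex.cpow_conj ((q : ℂ) / 2) (2 * (k : ℂ) + ν) h
  have h3 := Complex.Gamma_conj ((k : ℂ) + ν + 1)
  simp only [map_add, map_mul, map_div₀, map_natCast, map_ofNat, map_one, map_pow, map_neg,
    Complex.conj_ofReal] at h2 h3 ⊢
  rw [h2, h3]

theorem ofReal_Phi (τ : ℝ) {y : ℝ} (hy : 0 < y) :
    (Phi τ y : ℂ) = (√π : ℝ) / (2 * Complex.cosh (π * τ)) *
      (besselJ (I * τ) (√y : ℝ) ^ 2 + besselJ (I * ((-τ : ℝ) : ℂ)) (√y : ℝ) ^ 2) := by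
  have h := besselJ_conj (I * τ) (Real.sqrt_pos.2 hy)
  have e : starRingEnd ℂ (I * τ) = I * ((-τ : ℝ) : ℂ) := by simp
  rw [e] at h
  rw [h, ← map_pow, Complex.add_conj, Phi]
  push_cast
  ring

theorem integral_Ioo_besselJ_sq_eq (τ : ℝ) {γ x : ℝ} (hx : 0 < x) (hγ : 0 < γ) (hγ' : γ < 1 / 4) :
    2 * π * ((√π : ℝ) * ∫ y in Ioo 0 x, besselJ (I * τ) (√y : ℝ) ^ 2) =
      x * ∫ t : ℝ, barnesKernel (I * τ) (γ + t * I) * (x : ℂ) ^ (-((γ : ℂ) + t * I)) := by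
  have h1 := (integral_Ioo_besselJ_sq (ν := I * τ) (by simp) hx).tendsto_sum_nat.const_mul (2 * π : ℂ)
  have h2 := (tendsto_sum_barnesResidue τ hx hγ hγ').const_mul (x : ℂ)
  refine tendsto_nhds_unique (h1.congr fun n => ?_) h2
  rw [← Finset.mul_sum]
  ring

theorem integrableOn_besselJ_sq {ν : ℂ} (hν : ν.re = 0) {x : ℝ} (hx : 0 < x) :
    IntegrableOn (fun y : ℝ => besselJ ν (√y : ℝ) ^ 2) (Ioo 0 x) := by
  have hpi : ((√π : ℝ) : ℂ) ≠ 0 := by exact_mod_cast (Real.sqrt_pos.2 Real.pi_pos).ne'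
  have hsum := (hasSum_besselJ_sq hν hx).2
  have hmeas : AEStronglyMeasurable (fun y : ℝ => ((√π : ℝ) : ℂ) * besselJ ν (√y : ℝ) ^ 2)
      (volume.restrict (Ioo 0 x)) := by
    refine aestronglyMeasurable_of_tendsto_ae Filter.atTop
      (f := fun (m : ℕ) (y : ℝ) => ∑ n ∈ Finset.range m, besselJSqCoeff ν n * (y : ℂ) ^ (ν + n))
      (fun m => (integrable_finsetSum _ fun n _ =>
        integrableOn_besselJSqCoeff_mul_cpow hν hx n).aestronglyMeasurable) ?_
    filter_upwards [ae_restrict_mem measurableSet_Ioo] with y hy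
    exact (hasSum_besselJ_sq hν hy.1).1.tendsto_sum_nat
  have hb : IntegrableOn (fun y : ℝ => ((√π : ℝ) : ℂ) * besselJ ν (√y : ℝ) ^ 2) (Ioo 0 x) := by
    refine IntegrableOn.of_bound (by simp) hmeas (∑' n, ‖besselJSqCoeff ν n‖ * x ^ n) ?_
    filter_upwards [ae_restrict_mem measurableSet_Ioo] with y hy
    rw [← (hasSum_besselJ_sq hν hy.1).1.tsum_eq]
    refine tsum_of_norm_bounded hsum.hasSum fun n => ?_
    rw [norm_mul, Complex.norm_cpow_eq_rpow_re_of_pos hy.1]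
    have := hy.1.le
    have := hy.2.le
    simp only [Complex.add_re, hν, Complex.natCast_re, zero_add, Real.rpow_natCast]
    gcongr
  refine (hb.const_mul ((√π : ℝ) : ℂ)⁻¹).congr (Filter.Eventually.of_forall fun y => ?_)
  exact inv_mul_cancel_left₀ hpi _

theorem mellinBarnesRatio'_eq (γ τ t : ℝ) (hγ : 0 < γ) (hγ' : γ < 1 / 4) :
    mellinBarnesRatio' γ τ t = 1 / (2 * Complex.cosh (π * τ)) *
      (barnesKernel (I * τ) (γ + t * I) + barnesKernel (I * ((-τ : ℝ) : ℂ)) (γ + t * I)) := by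
  have hs : ((γ : ℂ) + t * I).re = γ := by simp
  have hg : ∀ z : ℂ, 0 < z.re → z.re < 1 → Complex.Gamma z ≠ 0 ∧ Complex.Gamma (1 - z) ≠ 0 :=
    fun z h1 h2 => ⟨Complex.Gamma_ne_zero_of_re_pos h1,
      Complex.Gamma_ne_zero_of_re_pos (by simp; linarith)⟩
  rw [mellinBarnesRatio', barnesKernel, barnesKernel]
  generalize (γ : ℂ) + t * I = s at *
  have ha := Complex.Gamma_mul_Gamma_one_sub s
  have hb := Complex.Gamma_mul_Gamma_one_sub (s + I * τ)
  have hc := Complex.Gamma_mul_Gamma_one_sub (s - I * τ)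
  have ha' := hg s (by linarith) (by linarith)
  have hb' := hg (s + I * τ) (by simp [hs, hγ]) (by simp [hs]; linarith)
  have hc' := hg (s - I * τ) (by simp [hs, hγ]) (by simp [hs]; linarith)
  have h2 : Complex.Gamma (2 - s) ≠ 0 := Complex.Gamma_ne_zero_of_re_pos (by simp [hs]; linarith)
  have hch : Complex.cosh (π * τ) ≠ 0 := by
    rw [← Complex.ofReal_mul, ← Complex.ofReal_cosh]
    exact_mod_cast (Real.cosh_pos _).ne'
  have hpi : (π : ℂ) ≠ 0 := by exact_mod_cast Real.pi_ne_zero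
  have hsin : Complex.sin (π * (s + I * τ)) + Complex.sin (π * (s - I * τ)) =
      2 * Complex.cosh (π * τ) * Complex.sin (π * s) := by
    rw [show (π : ℂ) * (s + I * τ) = π * s + π * τ * I by ring,
      show (π : ℂ) * (s - I * τ) = π * s - π * τ * I by ring, Complex.sin_add, Complex.sin_sub,
      Complex.cos_mul_I]
    ring
  have hne : ∀ {a b c : ℂ}, a * b = π / c → a ≠ 0 → b ≠ 0 → c ≠ 0 ∧ c = π / (a * b) := by
    intro a b c h h0 h1
    have hc0 : c ≠ 0 := fun h' => by
      rw [h', div_zero] at h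
      exact mul_ne_zero h0 h1 h
    refine ⟨hc0, ?_⟩
    rw [h]
    field_simp
  rw [(hne ha ha'.1 ha'.2).2, (hne hb hb'.1 hb'.2).2, (hne hc hc'.1 hc'.2).2] at hsin
  have e1 : 1 + I * τ - s = 1 - (s - I * τ) := by ring
  have e2 : 1 + I * ((-τ : ℝ) : ℂ) - s = 1 - (s + I * τ) := by push_cast; ring
  have e3 : s + I * ((-τ : ℝ) : ℂ) = s - I * τ := by push_cast; ring
  rw [e1, e2, e3]
  obtain ⟨ha1, ha2⟩ := ha'
  obtain ⟨hb1, hb2⟩ := hb'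
  obtain ⟨hc1, hc2⟩ := hc'
  clear ha hb hc hg hne e1 e2 e3
  generalize Complex.Gamma (s + I * τ) = B at *
  generalize Complex.Gamma (1 - (s + I * τ)) = B' at *
  generalize Complex.Gamma (s - I * τ) = C at *
  generalize Complex.Gamma (1 - (s - I * τ)) = C' at *
  generalize Complex.Gamma s = A at *
  generalize Complex.Gamma (1 - s) = A' at *
  generalize Complex.Gamma (2 - s) = D at *
  generalize Complex.Gamma (1 / 2 - s) = E at *
  generalize Complex.cosh (π * τ) = H at *
  have : B * C / (A * A') = 1 / (2 * H) * (B / C' + C / B') := by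
    field_simp at hsin ⊢
    linear_combination (-1 : ℂ) * hsin
  calc _ = B * C / (A * A') * (E / D) := by ring
    _ = _ := by rw [this]; ring

/-- For every `x > 0`, real `τ` and `γ ∈ (0, 1/4)`,
`(1/x) ∫_0^x Φ_τ(y) dy = (1/(2πi)) ∫_{γ−i∞}^{γ+i∞} Γ(s+iτ)Γ(s−iτ)Γ(1/2−s)
/(Γ(s)Γ(1−s)Γ(2−s)) x^{−s} ds`
(the line integral is written as `(1/(2π)) ∫_{t ∈ ℝ}` after substituting `s = γ + it`). -/
theorem Phi_average_mellinBarnes_rep (x τ γ : ℝ) (hx : 0 < x) (hγ : 0 < γ) (hγ' : γ < 1 / 4) :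
    (((1 / x) * ∫ y in Set.Ioo (0 : ℝ) x, Phi τ y : ℝ) : ℂ) = (1 / (2 * (π : ℂ))) *
      ∫ t : ℝ, mellinBarnesRatio' γ τ t * (x : ℂ) ^ (-((γ : ℂ) + t * Complex.I)) := by
  have hpi : (π : ℂ) ≠ 0 := by exact_mod_cast Real.pi_ne_zero
  have hxC : (x : ℂ) ≠ 0 := by exact_mod_cast hx.ne'
  have hK : ∀ σ : ℝ, Integrable fun t : ℝ =>
      barnesKernel (I * σ) (γ + t * I) * (x : ℂ) ^ (-((γ : ℂ) + t * I)) := fun σ => by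
    simpa using integrable_barnesKernel_mul_cpow_vertical σ hx hγ hγ' 0
  have hR : ∫ t : ℝ, mellinBarnesRatio' γ τ t * (x : ℂ) ^ (-((γ : ℂ) + t * I)) =
      1 / (2 * Complex.cosh (π * τ)) *
      ((∫ t : ℝ, barnesKernel (I * τ) (γ + t * I) * (x : ℂ) ^ (-((γ : ℂ) + t * I))) +
       ∫ t : ℝ, barnesKernel (I * ((-τ : ℝ) : ℂ)) (γ + t * I) * (x : ℂ) ^ (-((γ : ℂ) + t * I))) := by
    rw [← integral_add (hK τ) (hK (-τ)), ← integral_const_mul]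
    congr 1
    ext t
    rw [mellinBarnesRatio'_eq γ τ t hγ hγ']
    ring
  have hL : ((∫ y in Ioo 0 x, Phi τ y : ℝ) : ℂ) = (√π : ℝ) / (2 * Complex.cosh (π * τ)) *
      ((∫ y in Ioo 0 x, besselJ (I * τ) (√y : ℝ) ^ 2) +
       ∫ y in Ioo 0 x, besselJ (I * ((-τ : ℝ) : ℂ)) (√y : ℝ) ^ 2) := by
    rw [← integral_add (integrableOn_besselJ_sq (by simp) hx)
      (integrableOn_besselJ_sq (by simp) hx), ← integral_const_mul, ← integral_complex_ofReal]
    exact setIntegral_congr_fun measurableSet_Ioo fun y hy => ofReal_Phi τ hy.1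
  have h1 := integral_Ioo_besselJ_sq_eq τ hx hγ hγ'
  have h2 := integral_Ioo_besselJ_sq_eq (-τ) hx hγ hγ'
  rw [Complex.ofReal_mul, hL, hR]
  rw [mul_comm (x : ℂ), ← div_eq_iff hxC] at h1 h2
  rw [← h1, ← h2]
  push_cast
  field_simp
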